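/- Let m, n be positive integers with m ≥ 2 and let G = C_m ⊕ C_{mn}. Assume that C_m ⊕ C_m has Property D, i.e., every sequence over C_m ⊕ C_m of length 4m − 4 with no zero-sum subsequence of length m equals T^{m−1} for some sequence T (of length 4). Then every sequence S over G of length 2m + 2mn − 4 (which equals s(G) − 1) with no zero-sum subsequence of length mn = exp(G) is of one of the following two forms: (a) S = g^{tm−1} · (e_1 + g)^{(n+1−t)m−1} · (e_2 + g)^{sm−1} · (−x·e_1 + e_2 + g)^{(n+1−s)m−1} for some basis {e_1, e_2} of G with ord(e_2) = mn, some integer x with gcd(x, m) = 1, some s, t ∈ [1, n], and some g ∈ G; or (b) S = g^{mn−1} · (g_1 + g)^{m−1} · (g_2 + g)^{mn−1} · (−g_1 + g_2 + g)^{m−1} for some generating set {g_1, g_2} of G with ord(g_2) = mn and some g ∈ G. -/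

import Mathlib

theorem false_of_div_add_div_eq {m q r : ℕ} (hm : 3 ≤ m) (hq : 2 ≤ q) (hr : 2 ≤ r)
    (hN : 2 * (q + r - 1) < m)
    (hF : ∀ k, 1 ≤ k → k < m → k * q / m + k * r / m = k * (q + r - 1) / m)
    (hq0 : ∀ k, 1 ≤ k → k < m → k * q % m ≠ 0)
    (hr0 : ∀ k, 1 ≤ k → k < m → k * r % m ≠ 0)
    (d k : ℕ) (hd : m ≤ d * q) (hd' : (d - 1) * q < m) (hk : m ≤ k * r)
    (hk' : (k - 1) * r < m) (hdk : d < k) : False := by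
  have hm0 : 0 < m := by omega
  obtain ⟨N, hNd⟩ : ∃ N, N + 1 = q + r := ⟨q + r - 1, by omega⟩
  have hNe : q + r - 1 = N := by omega
  rw [hNe] at hN hF
  have hd3 : 3 ≤ d := by
    by_contra h
    have : d * q ≤ 2 * q := Nat.mul_le_mul_right _ (by omega)
    omega
  have hkm : k < m := by
    by_contra h
    have : (m - 1) * 2 ≤ (k - 1) * r := Nat.mul_le_mul (by omega) hr
    omega
  have symq : ∀ y, 1 ≤ y → y < m → (m - y) * q / m + y * q / m = q - 1 := by
    intro y h1 h2
    have e : (m - y) * q + y * q = m * q := by rw [← add_mul]; congr 1; omega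
    have a1 := Nat.div_add_mod ((m - y) * q) m
    have a2 := Nat.div_add_mod (y * q) m
    have b1 := Nat.mod_lt ((m - y) * q) hm0
    have b2 := Nat.mod_lt (y * q) hm0
    have c2 := hq0 y h1 h2
    set A := (m - y) * q / m
    set B := y * q / m
    have h3 : m * (A + B) < m * q := by rw [mul_add]; omega
    have h4 : m * q < m * (A + B + 2) := by rw [mul_add, mul_add]; omega
    have := Nat.lt_of_mul_lt_mul_left h3
    have := Nat.lt_of_mul_lt_mul_left h4
    omega
  have symr : (m - (k - 1)) * r / m + (k - 1) * r / m = r - 1 := by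
    have e : (m - (k-1)) * r + (k-1) * r = m * r := by rw [← add_mul]; congr 1; omega
    have a1 := Nat.div_add_mod ((m - (k-1)) * r) m
    have a2 := Nat.div_add_mod ((k-1) * r) m
    have b1 := Nat.mod_lt ((m - (k-1)) * r) hm0
    have b2 := Nat.mod_lt ((k-1) * r) hm0
    have c2 := hr0 (k-1) (by omega) (by omega)
    set A := (m - (k-1)) * r / m
    set B := (k-1) * r / m
    have h3 : m * (A + B) < m * r := by rw [mul_add]; omega
    have h4 : m * r < m * (A + B + 2) := by rw [mul_add, mul_add]; omega
    have := Nat.lt_of_mul_lt_mul_left h3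
    have := Nat.lt_of_mul_lt_mul_left h4
    omega
  have hr1 : (k - 1) * r / m = 0 := Nat.div_eq_of_lt hk'
  have hrk : 1 ≤ k * r / m := (Nat.one_le_div_iff hm0).2 hk
  -- `k` lies in the first half
  have hk2 : k ≤ m - (k - 1) := by
    by_contra h
    have h1 : m - (k - 1) ≤ k - 1 := by omega
    have := Nat.div_le_div_right (c := m) (Nat.mul_le_mul_right r h1)
    omega
  set i := k * q / m with hi
  -- a step never raises both floors
  have hNjump : k * N / m ≤ (k - 1) * N / m + 1 := by
    have e : k * N = (k - 1) * N + N := by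
      obtain ⟨j, rfl⟩ : ∃ j, k = j + 1 := ⟨k - 1, by omega⟩
      simp [add_mul]
    have : k * N ≤ (k - 1) * N + m := by omega
    calc k * N / m ≤ ((k - 1) * N + m) / m := Nat.div_le_div_right this
      _ = _ := Nat.add_div_right _ hm0
  have hik : (k - 1) * q / m = i := by
    have h1 := hF k (by omega) hkm
    have h2 := hF (k - 1) (by omega) (by omega)
    have h3 : (k - 1) * q / m ≤ k * q / m :=
      Nat.div_le_div_right (Nat.mul_le_mul_right _ (by omega))
    omega
  have hi1 : 1 ≤ i := by
    rw [hi, Nat.one_le_div_iff hm0]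
    exact hd.trans (Nat.mul_le_mul_right _ hdk.le)
  have hi2 : i + 1 ≤ q - 1 := by
    have h1 := symq (k - 1) (by omega) (by omega)
    have h2 : k * q / m ≤ (m - (k - 1)) * q / m :=
      Nat.div_le_div_right (Nat.mul_le_mul_right _ hk2)
    omega
  have ex1 : ∃ y, i * m ≤ y * q := ⟨k, by rw [hi]; exact Nat.div_mul_le_self _ _⟩
  have ex2 : ∃ y, (i + 1) * m ≤ y * q := ⟨m, by rw [mul_comm]; exact Nat.mul_le_mul_left _ (by omega)⟩
  obtain ⟨y1, h1, h1'⟩ : ∃ y, i * m ≤ y * q ∧ ∀ z < y, z * q < i * m :=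
    ⟨Nat.find ex1, Nat.find_spec ex1, fun z hz => not_le.1 (Nat.find_min ex1 hz)⟩
  obtain ⟨y2, h2, h2'⟩ : ∃ y, (i + 1) * m ≤ y * q ∧ ∀ z < y, z * q < (i + 1) * m :=
    ⟨Nat.find ex2, Nat.find_spec ex2, fun z hz => not_le.1 (Nat.find_min ex2 hz)⟩
  have hy1pos : 1 ≤ y1 := by
    rcases Nat.eq_zero_or_pos y1 with h | h
    · subst h
      have : 1 * m ≤ i * m := Nat.mul_le_mul_right _ hi1
      omega
    · exact h
  have hy1k : y1 < k := by
    by_contra h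
    have := h1' (k - 1) (by omega)
    have h3 := Nat.div_mul_le_self ((k - 1) * q) m
    rw [hik] at h3
    omega
  have hy2k : k < y2 := by
    by_contra h
    have h3 : y2 * q ≤ k * q := Nat.mul_le_mul_right _ (by omega)
    have h4 : k * q < (i + 1) * m := by
      rw [hi, mul_comm (_ + 1)]; exact Nat.lt_mul_div_succ _ hm0
    omega
  have hy2m : y2 < m := by
    by_contra h
    have h3 := h2' (m - 1) (by omega)
    have h4 : (i + 1) * m ≤ (q - 1) * m := Nat.mul_le_mul_right _ hi2
    have e : (q - 1) * m + m = q * m := by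
      obtain ⟨j, rfl⟩ : ∃ j, q = j + 1 := ⟨q - 1, by omega⟩
      simp [add_mul]
    have e' : (m - 1) * q + q = m * q := by
      obtain ⟨j, rfl⟩ : ∃ j, m = j + 1 := ⟨m - 1, by omega⟩
      simp [add_mul]
    rw [mul_comm m q] at e'
    omega
  have hgap : y2 ≤ y1 + d := by
    by_contra h
    have := h2' (y1 + d) (by omega)
    rw [add_mul, add_mul] at this
    omega
  -- the values of `⌊· N / m⌋` around `y1`, `k`, `y2`
  have hy1q : y1 * q / m = i := by
    apply le_antisymm
    · exact Nat.div_le_div_right (Nat.mul_le_mul_right _ hy1k.le)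
    · exact (Nat.le_div_iff_mul_le hm0).2 h1
  have hy1q' : (y1 - 1) * q / m < i := (Nat.div_lt_iff_lt_mul hm0).2 (h1' _ (by omega))
  have hy2q : i + 1 ≤ y2 * q / m := (Nat.le_div_iff_mul_le hm0).2 h2
  have hdN : (d - 1) * N < m := by
    have hlt : (d - 1) * N / m = 0 := by
      rw [← hF (d - 1) (by omega) (by omega), Nat.div_eq_of_lt hd',
        Nat.div_eq_of_lt (lt_of_le_of_lt (Nat.mul_le_mul_right r (by omega)) hk')]
    rcases Nat.div_eq_zero_iff.1 hlt with h | h <;> omega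
  have gap : ∀ y z, 1 ≤ y → y ≤ z → (y - 1) * N / m + 2 ≤ z * N / m → d ≤ z - y + 1 := by
    intro y z hy hyz h
    by_contra hc
    have e : z * N = (y - 1) * N + (z - y + 1) * N := by rw [← add_mul]; congr 1; omega
    have : (z - y + 1) * N ≤ (d - 1) * N := Nat.mul_le_mul_right _ (by omega)
    have : z * N ≤ (y - 1) * N + m := by omega
    have := Nat.div_le_div_right (c := m) this
    rw [Nat.add_div_right _ hm0] at this
    omega
  have v0 : (y1 - 1) * N / m < i := by
    rcases Nat.lt_or_ge 1 y1 with h | h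
    · rw [← hF (y1 - 1) (by omega) (by omega),
        Nat.div_eq_of_lt (lt_of_le_of_lt (Nat.mul_le_mul_right r (by omega)) hk')]
      exact hy1q'
    · have : y1 - 1 = 0 := by omega
      simp [this]; omega
  have v2 := hF k (by omega) hkm
  have v1 := hF (k - 1) (by omega) (by omega)
  have v3 := hF y2 (by omega) hy2m
  have hr2 : k * r / m ≤ y2 * r / m := Nat.div_le_div_right (Nat.mul_le_mul_right _ hy2k.le)
  have g1 := gap y1 k hy1pos hy1k.le (by omega)
  have g2 := gap k y2 (by omega) hy2k.le (by omega)
  omega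

theorem false_of_div_add_div_add_div_eq {m p q r : ℕ} (hm : 3 ≤ m) (hq : 2 ≤ q) (hr : 2 ≤ r)
    (hsum : p + q + r = m + 1)
    (hp0 : ∀ k, 1 ≤ k → k < m → k * p % m ≠ 0)
    (hq0 : ∀ k, 1 ≤ k → k < m → k * q % m ≠ 0)
    (hr0 : ∀ k, 1 ≤ k → k < m → k * r % m ≠ 0)
    (hF : ∀ k, 1 ≤ k → k < m → k * p / m + k * q / m + k * r / m = k - 1)
    (h2 : m ≤ 2 * p) : False := by
  have hm0 : 0 < m := by omega
  have hp2 : 2 * p ≠ m := by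
    intro h
    exact hp0 2 (by omega) (by omega) (by simp [h])
  have hN : 2 * (q + r - 1) < m := by omega
  have hF' : ∀ k, 1 ≤ k → k < m → k * q / m + k * r / m = k * (q + r - 1) / m := by
    intro k h1 hk
    have e : k * p + k * (q + r - 1) = k * m := by rw [← mul_add]; congr 1; omega
    have a1 := Nat.div_add_mod (k * p) m
    have a2 := Nat.div_add_mod (k * (q + r - 1)) m
    have b1 := Nat.mod_lt (k * p) hm0
    have b2 := Nat.mod_lt (k * (q + r - 1)) hm0
    have c2 := hp0 k h1 hk
    have := hF k h1 hk
    rw [mul_comm k m] at e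
    set A := k * p / m
    set B := k * (q + r - 1) / m
    have h3 : m * (A + B) < m * k := by rw [mul_add]; omega
    have h4 : m * k < m * (A + B + 2) := by rw [mul_add, mul_add]; omega
    have := Nat.lt_of_mul_lt_mul_left h3
    have := Nat.lt_of_mul_lt_mul_left h4
    omega
  have first : ∀ q, 2 ≤ q → ∃ d, m ≤ d * q ∧ (d - 1) * q < m := by
    intro q hq
    have ex : ∃ d, m ≤ d * q := ⟨m, Nat.le_mul_of_pos_right _ (by omega)⟩
    refine ⟨Nat.find ex, Nat.find_spec ex, not_le.1 (Nat.find_min ex ?_)⟩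
    have : Nat.find ex ≠ 0 := fun h => by have := Nat.find_spec ex; rw [h] at this; omega
    omega
  obtain ⟨d, hd, hd'⟩ := first q hq
  obtain ⟨k, hk, hk'⟩ := first r hr
  rcases lt_trichotomy d k with h | h | h
  · exact false_of_div_add_div_eq hm hq hr hN hF' hq0 hr0 d k hd hd' hk hk' h
  · subst h
    have hdm : d < m := by
      by_contra h
      have : (m - 1) * 2 ≤ (d - 1) * r := Nat.mul_le_mul (by omega) hr
      omega
    have hd1 : 1 ≤ d := by
      rcases Nat.eq_zero_or_pos d with h | h
      · subst h; omega
      · exact h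
    have h1 := hF' d hd1 hdm
    have a : 1 ≤ d * q / m := (Nat.one_le_div_iff hm0).2 hd
    have b : 1 ≤ d * r / m := (Nat.one_le_div_iff hm0).2 hk
    have e : d * (q + r - 1) ≤ (d - 1) * q + (d - 1) * r + (q + r - 1) := by
      obtain ⟨j, rfl⟩ : ∃ j, d = j + 1 := ⟨d - 1, by omega⟩
      obtain ⟨q, rfl⟩ : ∃ j, q = j + 1 := ⟨q - 1, by omega⟩
      simp only [Nat.add_sub_cancel, show q + 1 + r - 1 = q + r by omega]
      nlinarith
    have hd1' : 2 ≤ d := by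
      by_contra h
      have : d = 1 := by omega
      subst this
      omega
    have c := hF' (d - 1) (by omega) (by omega)
    rw [Nat.div_eq_of_lt hd', Nat.div_eq_of_lt hk'] at c
    have c' : (d - 1) * (q + r - 1) < m := by
      rcases Nat.div_eq_zero_iff.1 c.symm with h | h <;> omega
    have e' : d * (q + r - 1) = (d - 1) * (q + r - 1) + (q + r - 1) := by
      obtain ⟨j, rfl⟩ : ∃ j, d = j + 1 := ⟨d - 1, by omega⟩
      simp [add_mul]
    have : d * (q + r - 1) / m < 2 := (Nat.div_lt_iff_lt_mul hm0).2 (by omega)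
    omega
  · refine false_of_div_add_div_eq hm hr hq (by omega) (fun k h1 h2 => ?_) hr0 hq0 k d
      hk hk' hd hd' h
    rw [add_comm, hF' k h1 h2, add_comm q r]

/-- White's theorem on empty lattice tetrahedra, in arithmetic form. -/
theorem white_arithmetic {m u v : ℕ} (hm : 2 ≤ m) (hu : u < m) (hv : v < m)
    (hu0 : ∀ k, 1 ≤ k → k < m → k * u % m ≠ 0)
    (hv0 : ∀ k, 1 ≤ k → k < m → k * v % m ≠ 0)
    (h : ∀ k, 1 ≤ k → k < m → m < k + k * u % m + k * v % m ∧ k + k * u % m + k * v % m < 2 * m) :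
    u + 1 = m ∨ v + 1 = m ∨ u + v = m := by
  have hm0 : 0 < m := by omega
  have u1 := hu0 1 le_rfl (by omega)
  have v1 := hv0 1 le_rfl (by omega)
  have h1 := h 1 le_rfl (by omega)
  rw [one_mul, one_mul, Nat.mod_eq_of_lt hu, Nat.mod_eq_of_lt hv] at h1
  rw [one_mul, Nat.mod_eq_of_lt hu] at u1
  rw [one_mul, Nat.mod_eq_of_lt hv] at v1
  by_contra! hc
  obtain ⟨c1, c2, c3⟩ := hc
  obtain ⟨p, hp⟩ : ∃ p, p + u = m := ⟨m - u, by omega⟩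
  obtain ⟨q, hq⟩ : ∃ q, q + v = m := ⟨m - v, by omega⟩
  obtain ⟨r, hr⟩ : ∃ r, r + m = u + v + 1 := ⟨u + v + 1 - m, by omega⟩
  have key : ∀ k, 1 ≤ k → k < m → k * p % m ≠ 0 ∧ k * q % m ≠ 0 ∧ k * r % m ≠ 0 ∧
      k * p / m + k * q / m + k * r / m = k - 1 := by
    intro k hk1 hk2
    have e1 : k * p + k * u = m * k := by rw [← mul_add, hp, mul_comm]
    have e2 : k * q + k * v = m * k := by rw [← mul_add, hq, mul_comm]
    have e3 : k * r + m * k = k * u + k * v + k := by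
      rw [mul_comm m k, ← mul_add, hr]; ring
    have a1 := Nat.div_add_mod (k * u) m
    have a2 := Nat.div_add_mod (k * v) m
    have b1 := Nat.mod_lt (k * u) hm0
    have b2 := Nat.mod_lt (k * v) hm0
    have n1 := hu0 k hk1 hk2
    have n2 := hv0 k hk1 hk2
    obtain ⟨l1, l2⟩ := h k hk1 hk2
    set A := k * u / m
    set B := k * v / m
    have hA : A + 1 ≤ k := by
      have : m * A < m * k := by omega
      exact Nat.lt_of_mul_lt_mul_left this
    have hB : B + 1 ≤ k := by
      have : m * B < m * k := by omega
      exact Nat.lt_of_mul_lt_mul_left this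
    obtain ⟨A', hA'⟩ : ∃ x, x + A + 1 = k := ⟨k - A - 1, by omega⟩
    obtain ⟨B', hB'⟩ : ∃ x, x + B + 1 = k := ⟨k - B - 1, by omega⟩
    have mA : m * A' + m * A + m = m * k := by rw [← hA']; ring
    have mB : m * B' + m * B + m = m * k := by rw [← hB']; ring
    have hC : k ≤ A + B + 1 := by
      have : m * k < m * (A + B + 2) := by rw [mul_add, mul_add]; omega
      have := Nat.lt_of_mul_lt_mul_left this
      omega
    obtain ⟨C', hC'⟩ : ∃ x, x + k = A + B + 1 := ⟨A + B + 1 - k, by omega⟩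
    have mC : m * C' + m * k = m * A + m * B + m := by rw [← mul_add, hC']; ring
    have dp := (Nat.div_mod_unique (a := k * p) (c := m - k * u % m) (d := A') hm0).2 ⟨by omega, by omega⟩
    have dq := (Nat.div_mod_unique (a := k * q) (c := m - k * v % m) (d := B') hm0).2 ⟨by omega, by omega⟩
    have dr := (Nat.div_mod_unique (a := k * r) (c := k + k * u % m + k * v % m - m) (d := C') hm0).2
      ⟨by omega, by omega⟩
    omega
  have hp0 := fun k a b => (key k a b).1
  have hq0 := fun k a b => (key k a b).2.1
  have hr0 := fun k a b => (key k a b).2.2.1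
  have hF := fun k a b => (key k a b).2.2.2
  have hm3 : 3 ≤ m := by omega
  have h2 := hF 2 (by omega) (by omega)
  by_cases g1 : m ≤ 2 * p
  · exact false_of_div_add_div_add_div_eq hm3 (by omega) (by omega) (by omega) hp0 hq0 hr0 hF g1
  by_cases g2 : m ≤ 2 * q
  · exact false_of_div_add_div_add_div_eq (p := q) (q := p) (r := r) hm3 (by omega) (by omega)
      (by omega) hq0 hp0 hr0 (fun k a b => by have := hF k a b; omega) g2
  by_cases g3 : m ≤ 2 * r
  · exact false_of_div_add_div_add_div_eq (p := r) (q := p) (r := q) hm3 (by omega) (by omega)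
      (by omega) hr0 hp0 hq0 (fun k a b => by have := hF k a b; omega) g3
  rw [Nat.div_eq_of_lt (not_le.1 g1), Nat.div_eq_of_lt (not_le.1 g2),
    Nat.div_eq_of_lt (not_le.1 g3)] at h2
  omega

/-- `S` has no zero-sum subsequence of length `k`. -/
def NoZeroSum {A : Type*} [AddCommGroup A] (k : ℕ) (S : Multiset A) : Prop :=
  ¬ ∃ U ≤ S, U.sum = 0 ∧ Multiset.card U = k

section Multiset

variable {A B : Type*}

theorem Multiset.exists_le_map_eq (f : A → B) (S : Multiset A) :
    ∀ U ≤ S.map f, ∃ V ≤ S, V.map f = U := by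
  classical
  induction S using Multiset.induction with
  | empty => intro U hU; exact ⟨0, le_rfl, by simpa using (Multiset.le_zero.1 hU).symm⟩
  | cons a S ih =>
    intro U hU
    rw [Multiset.map_cons] at hU
    by_cases h : f a ∈ U
    · obtain ⟨V, hV, hVU⟩ := ih (U.erase (f a)) (Multiset.erase_le_iff_le_cons.2 hU)
      exact ⟨a ::ₘ V, Multiset.cons_le_cons _ hV, by simp [hVU, Multiset.cons_erase h]⟩
    · obtain ⟨V, hV, hVU⟩ := ih U ((Multiset.le_cons_of_notMem h).1 hU)
      exact ⟨V, hV.trans (Multiset.le_cons_self _ _), hVU⟩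

theorem Multiset.exists_le_of_le_card (S : Multiset A) {k : ℕ} (h : k ≤ Multiset.card S) :
    ∃ U ≤ S, Multiset.card U = k := by
  obtain ⟨l, rfl⟩ := Quot.exists_rep S
  exact ⟨(l.take k : List A), (List.take_sublist k l).subperm, by simpa using h⟩

theorem Multiset.exists_eq_map (f : A → B) (P : A → Prop) (S : Multiset B) :
    (∀ b ∈ S, ∃ a, b = f a ∧ P a) → ∃ X : Multiset A, S = X.map f ∧ ∀ a ∈ X, P a := by
  induction S using Multiset.induction with
  | empty => intro _; exact ⟨0, by simp, by simp⟩
  | cons b S ih =>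
    intro h
    obtain ⟨X, rfl, hX⟩ := ih fun c hc => h c (Multiset.mem_cons_of_mem hc)
    obtain ⟨a, rfl, ha⟩ := h b (Multiset.mem_cons_self _ _)
    refine ⟨a ::ₘ X, by simp, fun c hc => ?_⟩
    rcases Multiset.mem_cons.1 hc with rfl | hc
    · exact ha
    · exact hX c hc

theorem Multiset.sum_map_replicate (m : ℕ) (X : Multiset A) :
    (X.map (Multiset.replicate m)).sum = m • X := by
  induction X using Multiset.induction with
  | empty => simp
  | cons a X ih =>
    rw [Multiset.map_cons, Multiset.sum_cons, ih, ← Multiset.singleton_add a X, nsmul_add,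
      Multiset.nsmul_singleton]

end Multiset

open scoped Pointwise in
theorem exists_finset_subsums {p : ℕ} (hp : p.Prime) (h : ℕ) :
    ∀ W : Multiset (ZMod p), 0 ∉ W → (∀ x, W.count x ≤ h) →
      ∃ X : Finset (ZMod p), X.Nonempty ∧ min p (1 + Multiset.card W) ≤ X.card ∧
        ∀ x ∈ X, ∃ V ≤ W, Multiset.card V ≤ h ∧ V.sum = x := by
  induction h with
  | zero =>
    intro W _ hc
    have : W = 0 := Multiset.eq_zero_of_forall_notMem fun x hx => by
      have := Multiset.count_pos.2 hx
      have := hc x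
      omega
    subst this
    exact ⟨{0}, by simp, by simp, fun x hx => ⟨0, le_rfl, by simp, (by simpa using hx : x = 0).symm⟩⟩
  | succ h ih =>
    intro W h0 hc
    have hle : W.dedup ≤ W := Multiset.dedup_le W
    obtain ⟨X, hX, hXc, hXs⟩ := ih (W - W.dedup)
      (fun hh => h0 (Multiset.mem_of_le (Multiset.sub_le_self _ _) hh)) (fun x => by
        rw [Multiset.count_sub, Multiset.count_dedup]
        have := hc x
        split_ifs with hx
        · omega
        · rw [Multiset.count_eq_zero_of_notMem hx]; omega)
    refine ⟨insert 0 W.toFinset + X, (Finset.insert_nonempty _ _).add hX, ?_, ?_⟩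
    · refine le_trans ?_ (ZMod.cauchy_davenport hp (Finset.insert_nonempty _ _) hX)
      have h1 : (insert 0 W.toFinset).card = W.toFinset.card + 1 :=
        Finset.card_insert_of_notMem (by simpa using h0)
      have h2 : Multiset.card (W - W.dedup) = Multiset.card W - W.toFinset.card := by
        rw [Multiset.card_sub hle]; rfl
      have h3 : W.toFinset.card ≤ Multiset.card W := Multiset.card_le_card hle
      rw [h2] at hXc
      rw [h1]
      omega
    · intro x hx
      obtain ⟨a, ha, y, hy, rfl⟩ := Finset.mem_add.1 hx
      obtain ⟨V, hV, hVc, rfl⟩ := hXs y hy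
      rcases Finset.mem_insert.1 ha with rfl | ha
      · exact ⟨V, hV.trans (Multiset.sub_le_self _ _), by omega, by simp⟩
      · refine ⟨{a} + V, ?_, by simp; omega, by simp⟩
        calc {a} + V ≤ W.dedup + (W - W.dedup) := add_le_add
              (Multiset.singleton_le.2 (Multiset.mem_dedup.2 (Multiset.mem_toFinset.1 ha))) hV
          _ = W := add_tsub_cancel_of_le hle

theorem exists_subsum_eq {p : ℕ} (hp : p.Prime) (h : ℕ) (W : Multiset (ZMod p)) (h0 : 0 ∉ W)
    (hc : ∀ x, W.count x ≤ h) (hW : p ≤ Multiset.card W + 1) (y : ZMod p) :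
    ∃ V ≤ W, Multiset.card V ≤ h ∧ V.sum = y := by
  have := Fact.mk hp
  obtain ⟨X, -, hX, hs⟩ := exists_finset_subsums hp h W h0 hc
  have : X = Finset.univ := by
    apply Finset.eq_univ_of_card
    have := X.card_le_univ
    rw [ZMod.card] at this ⊢
    omega
  exact hs y (this ▸ Finset.mem_univ y)

/-- The inverse Erdős–Ginzburg–Ziv statement in `ZMod n`. -/
def InverseEGZ (n : ℕ) : Prop :=
  ∀ S : Multiset (ZMod n), Multiset.card S = 2 * n - 2 →
    (¬ ∃ U ≤ S, U.sum = 0 ∧ Multiset.card U = n) →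
    ∃ a b, S = Multiset.replicate (n - 1) a + Multiset.replicate (n - 1) b

theorem InverseEGZ.of_prime {p : ℕ} (hp : p.Prime) : InverseEGZ p := by
  have := Fact.mk hp
  have hp2 := hp.two_le
  intro S hS hno
  obtain ⟨a, ha⟩ : ∃ a, ∀ x, S.count x ≤ S.count a := Finite.exists_max _
  set h := S.count a with hh
  set S' := S.map (fun x => x - a) with hS'
  have hback : S'.map (fun x => x + a) = S := by simp [hS', Multiset.map_map]
  have hno' : ¬ ∃ U ≤ S', U.sum = 0 ∧ Multiset.card U = p := by
    rintro ⟨U, hU, hs, hc⟩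
    refine hno ⟨U.map (fun x => x + a), ?_, ?_, by simpa using hc⟩
    · rw [← hback]; exact Multiset.map_le_map hU
    · simp [Multiset.sum_map_add, hs, hc]
  have hcnt : ∀ x, S'.count x = S.count (x + a) := by
    intro x
    have := Multiset.count_map_eq_count' (fun x => x - a) S (sub_left_injective) (x + a)
    simpa using this
  have hcard' : Multiset.card S' = 2 * p - 2 := by simp [hS', hS]
  set W := S'.filter (fun x => x ≠ 0) with hWdef
  have hS'W : S' = Multiset.replicate h 0 + W := by
    have h1 := (Multiset.filter_add_not (fun x => x = 0) S').symm
    rw [Multiset.filter_eq' S' 0, hcnt, zero_add] at h1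
    exact h1
  have h0W : (0 : ZMod p) ∉ W := by simp [hWdef]
  have hWc : ∀ x, W.count x ≤ h := fun x => by
    refine (Multiset.count_le_of_le x (Multiset.filter_le _ _)).trans ?_
    rw [hcnt]; exact ha _
  have hcW : h + Multiset.card W = 2 * p - 2 := by
    rw [← hcard', hS'W]; simp
  have hhp : h ≤ p - 1 := by
    by_contra hlt
    refine hno' ⟨Multiset.replicate p 0, ?_, by simp, by simp⟩
    rw [hS'W]
    exact (Multiset.replicate_mono 0 (by omega)).trans (Multiset.le_add_right _ _)
  have hWp : Multiset.card W < p := by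
    by_contra hge
    obtain ⟨W', hW', hW'c⟩ := Multiset.exists_le_of_le_card W (not_lt.1 hge)
    obtain ⟨V, hV, hVc, hVs⟩ := exists_subsum_eq hp h W'
      (fun h => h0W (Multiset.mem_of_le hW' h))
      (fun x => (Multiset.count_le_of_le x hW').trans (hWc x)) (by omega) W'.sum
    have hVp : Multiset.card V ≤ p := by omega
    refine hno' ⟨Multiset.replicate (Multiset.card V) 0 + (W' - V), ?_, ?_, ?_⟩
    · rw [hS'W]
      exact add_le_add (Multiset.replicate_mono 0 hVc)
        ((Multiset.sub_le_self _ _).trans hW')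
    · have : (W' - V).sum + V.sum = W'.sum := by
        rw [← Multiset.sum_add, Multiset.sub_add_cancel hV]
      simpa [hVs] using this
    · rw [Multiset.card_add, Multiset.card_sub hV, Multiset.card_replicate]; omega
  have hhe : h = p - 1 := by omega
  have hWe : Multiset.card W = p - 1 := by omega
  obtain ⟨b, hb⟩ : ∃ b, p - 1 ≤ W.count b := by
    by_contra! hlt
    obtain ⟨V, hV, hVc, hVs⟩ := exists_subsum_eq hp (p - 2) W h0W
      (fun x => by have := hlt x; omega) (by omega) W.sum
    refine hno' ⟨Multiset.replicate (p - Multiset.card (W - V)) 0 + (W - V), ?_, ?_, ?_⟩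
    · rw [hS'W]
      refine add_le_add (Multiset.replicate_mono 0 ?_) (Multiset.sub_le_self _ _)
      rw [Multiset.card_sub hV]; omega
    · have : (W - V).sum + V.sum = W.sum := by
        rw [← Multiset.sum_add, Multiset.sub_add_cancel hV]
      simpa [hVs] using this
    · have := Multiset.card_sub hV
      simp only [Multiset.card_add, Multiset.card_replicate]; omega
  refine ⟨a, b + a, ?_⟩
  have hWb : W = Multiset.replicate (p - 1) b :=
    (Multiset.eq_of_le_of_card_le (Multiset.le_count_iff_replicate_le.1 hb) (by simp [hWe])).symm
  rw [← hback, hS'W, hWb, hhe]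
  simp

section NoZeroSum

variable {A : Type*} [AddCommGroup A]

theorem NoZeroSum.mono {k : ℕ} {S S' : Multiset A} (h : NoZeroSum k S) (hS : S' ≤ S) :
    NoZeroSum k S' := fun ⟨U, hU, hU'⟩ => h ⟨U, hU.trans hS, hU'⟩

theorem NoZeroSum.count_lt [DecidableEq A] {k : ℕ} {S : Multiset A} (h : NoZeroSum k S)
    (hexp : ∀ x : A, k • x = 0) (x : A) : S.count x < k := by
  by_contra hc
  exact h ⟨Multiset.replicate k x, Multiset.le_count_iff_replicate_le.1 (not_lt.1 hc),
    by simp [hexp], by simp⟩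

theorem NoZeroSum.nodup {m : ℕ} (hm : 2 ≤ m) (hexp : ∀ x : A, m • x = 0) {T : Multiset A}
    (h : NoZeroSum m ((m - 1) • T)) : T.Nodup := by
  classical
  rw [Multiset.nodup_iff_count_le_one]
  intro a
  by_contra hc
  have := h.count_lt hexp a
  rw [Multiset.count_nsmul] at this
  have : (m - 1) * 2 ≤ (m - 1) * T.count a := Nat.mul_le_mul_left _ (by omega)
  omega

/-- The difference of the two values of an extremal sequence over `ZMod n` generates `ZMod n`. -/
theorem NoZeroSum.exists_nsmul_eq {n : ℕ} (hn : 0 < n) {a b : ZMod n}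
    (h : NoZeroSum n (Multiset.replicate (n - 1) a + Multiset.replicate (n - 1) b))
    (z : ZMod n) : ∃ i < n, z = i • (a - b) := by
  have : NeZero n := ⟨hn.ne'⟩
  have hinj : Set.InjOn (fun i : ℕ => i • (a - b)) (Finset.range n) := by
    have aux : ∀ i j : ℕ, i < j → j < n → i • (a - b) ≠ j • (a - b) := by
      intro i j hij hj he
      apply h
      refine ⟨Multiset.replicate (j - i) a + Multiset.replicate (n - (j - i)) b,
        add_le_add (Multiset.replicate_mono _ (by omega)) (Multiset.replicate_mono _ (by omega)),
        ?_, by simp; omega⟩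
      have e : (j - i) • (a - b) = 0 := by
        rw [sub_nsmul _ hij.le, he, add_neg_cancel]
      have e2 : n • b = 0 := by simp
      rw [Multiset.sum_add, Multiset.sum_replicate, Multiset.sum_replicate]
      have e3 : n • b = (n - (j - i)) • b + (j - i) • b := by
        rw [← add_nsmul]; congr 1; omega
      rw [nsmul_sub, sub_eq_zero] at e
      rw [e, add_comm, ← e3, e2]
    intro i hi j hj he
    simp only [Finset.coe_range, Set.mem_Iio] at hi hj
    rcases lt_trichotomy i j with hl | hl | hl
    · exact absurd he (aux i j hl hj)
    · exact hl
    · exact absurd he.symm (aux j i hl hi)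
  have hc : (Finset.univ : Finset (ZMod n)).card ≤ (Finset.range n).card := by
    simp [ZMod.card]
  obtain ⟨i, hi, hz⟩ := Finset.surj_on_of_inj_on_of_card_le (s := Finset.range n)
    (t := (Finset.univ : Finset (ZMod n))) (fun i _ => i • (a - b)) (fun _ _ => Finset.mem_univ _)
    (fun i j hi hj he => hinj (by simpa using hi) (by simpa using hj) he) hc z (Finset.mem_univ z)
  exact ⟨i, by simpa using hi, hz⟩

theorem NoZeroSum.sum_eq {n : ℕ} (hn : 2 ≤ n) {a b z : ZMod n}
    (h : NoZeroSum n (Multiset.replicate (n - 1) a + Multiset.replicate (n - 1) b))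
    (hz : ∀ Y ≤ Multiset.replicate (n - 1) a + Multiset.replicate (n - 1) b,
      Multiset.card Y = n - 2 → z + Y.sum ≠ 0) : z = a + b := by
  obtain ⟨i, hi, he⟩ := h.exists_nsmul_eq (by omega) (z - (a + b))
  rcases Nat.eq_zero_or_pos i with rfl | hi0
  · rw [zero_nsmul, sub_eq_zero] at he; exact he
  exfalso
  refine hz (Multiset.replicate (n - 1 - i) a + Multiset.replicate (i - 1) b)
    (add_le_add (Multiset.replicate_mono _ (by omega)) (Multiset.replicate_mono _ (by omega)))
    (by simp; omega) ?_
  rw [Multiset.sum_add, Multiset.sum_replicate, Multiset.sum_replicate, eq_add_of_sub_eq he]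
  obtain ⟨j, rfl⟩ : ∃ j, i = j + 1 := ⟨i - 1, by omega⟩
  obtain ⟨l, rfl⟩ : ∃ l, n = l + j + 2 := ⟨n - j - 2, by omega⟩
  have e2 : (l + j + 2) • a = 0 := by simp
  rw [show l + j + 2 - 1 - (j + 1) = l by omega, show j + 1 - 1 = j by omega, ← e2]
  module

theorem NoZeroSum.eq_of_cons {n : ℕ} (hn : 2 ≤ n) (hK : InverseEGZ n) {M : Multiset (ZMod n)}
    {x y : ZMod n} (hM : Multiset.card M = 2 * n - 3) (hx : NoZeroSum n (x ::ₘ M))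
    (hy : NoZeroSum n (y ::ₘ M)) : x = y := by
  obtain ⟨a, b, hab⟩ := hK (x ::ₘ M) (by simp [hM]; omega) hx
  wlog hxa : x = a generalizing a b
  · refine this b a (by rw [hab, add_comm]) ?_
    have : x ∈ x ::ₘ M := Multiset.mem_cons_self _ _
    rw [hab, Multiset.mem_add] at this
    rcases this with h | h
    · exact absurd (Multiset.eq_of_mem_replicate h) hxa
    · exact Multiset.eq_of_mem_replicate h
  subst hxa
  have hMe : M = Multiset.replicate (n - 2) x + Multiset.replicate (n - 1) b := by
    rw [show n - 1 = n - 2 + 1 by omega, Multiset.replicate_succ, Multiset.cons_add,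
      Multiset.cons_inj_right] at hab
    rw [hab, show n - 1 = n - 2 + 1 by omega]
  rw [hab] at hx
  obtain ⟨i, hi, he⟩ := hx.exists_nsmul_eq (by omega) (y - x)
  rcases Nat.eq_zero_or_pos i with rfl | hi0
  · rw [zero_nsmul, sub_eq_zero] at he; exact he.symm
  exfalso
  refine hy ⟨y ::ₘ (Multiset.replicate (n - 1 - i) x + Multiset.replicate i b), ?_, ?_,
    by simp; omega⟩
  · rw [hMe]
    exact Multiset.cons_le_cons _ (add_le_add (Multiset.replicate_mono _ (by omega))
      (Multiset.replicate_mono _ (by omega)))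
  · rw [Multiset.sum_cons, Multiset.sum_add, Multiset.sum_replicate, Multiset.sum_replicate,
      eq_add_of_sub_eq he]
    obtain ⟨l, rfl⟩ : ∃ l, n = l + i + 1 := ⟨n - i - 1, by omega⟩
    have e2 : (l + i + 1) • x = 0 := by simp
    rw [show l + i + 1 - 1 - i = l by omega, ← e2]
    module

end NoZeroSum

section Blocks

variable {G H : Type*} [AddCommGroup G] [AddCommGroup H]

theorem exists_blocks (φ : G →+ H) {m c : ℕ} (hm : 1 ≤ m)
    (hext : ∀ S : Multiset H, c < Multiset.card S → ¬ NoZeroSum m S) (k : ℕ) :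
    ∀ S : Multiset G, Multiset.card S = c + k * m → ∃ (B : Multiset (Multiset G)) (R : Multiset G),
      B.sum + R = S ∧ Multiset.card B = k ∧ ∀ b ∈ B, Multiset.card b = m ∧ φ b.sum = 0 := by
  induction k with
  | zero => intro S _; exact ⟨0, S, by simp, by simp, by simp⟩
  | succ k ih =>
    intro S hS
    have h1 := hext (S.map φ) (by rw [Multiset.card_map, hS]; nlinarith)
    obtain ⟨U, hU, hU0, hUc⟩ := not_not.1 h1
    obtain ⟨V, hV, rfl⟩ := Multiset.exists_le_map_eq φ S U hU
    classical
    obtain ⟨W, rfl⟩ := Multiset.le_iff_exists_add.1 hV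
    rw [Multiset.card_map] at hUc
    obtain ⟨B, R, hBR, hB, hb⟩ := ih W (by
      rw [Multiset.card_add, hUc, add_mul] at hS; omega)
    refine ⟨V ::ₘ B, R, by rw [Multiset.sum_cons, add_assoc, hBR], by simp [hB], fun b hbm => ?_⟩
    rcases Multiset.mem_cons.1 hbm with rfl | hbm
    · exact ⟨hUc, by rw [map_multiset_sum, hU0]⟩
    · exact hb b hbm

theorem exists_block_sums (φ : G →+ H) {m q : ℕ} (ι : ZMod q →+ G)
    (hker : ∀ g, φ g = 0 → ∃ k, ι k = g) {S : Multiset G} (hS : NoZeroSum (m * q) S)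
    {B : Multiset (Multiset G)} (hBS : B.sum ≤ S)
    (hB : ∀ b ∈ B, Multiset.card b = m ∧ φ b.sum = 0) :
    ∃ M : Multiset (ZMod q), M.map ι = B.map Multiset.sum ∧ NoZeroSum q M := by
  obtain ⟨M, hM, -⟩ := Multiset.exists_eq_map ι (fun _ => True) (B.map Multiset.sum) (by
    intro x hx
    obtain ⟨b, hb, rfl⟩ := Multiset.mem_map.1 hx
    obtain ⟨k, hk⟩ := hker _ (hB b hb).2
    exact ⟨k, hk.symm, trivial⟩)
  refine ⟨M, hM.symm, ?_⟩
  rintro ⟨U, hU, hU0, hUc⟩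
  obtain ⟨V, hV, hVU⟩ := Multiset.exists_le_map_eq Multiset.sum B (U.map ι)
    (by rw [hM]; exact Multiset.map_le_map hU)
  have hVc : Multiset.card V = q := by
    rw [← hUc, ← Multiset.card_map ι U, ← hVU, Multiset.card_map]
  refine hS ⟨V.sum, ?_, ?_, ?_⟩
  · obtain ⟨W, rfl⟩ := Multiset.le_iff_exists_add.1 hV
    rw [Multiset.sum_add] at hBS
    exact (Multiset.le_add_right _ _).trans hBS
  · have : (V.map Multiset.sum).sum = V.sum.sum :=
      (map_multiset_sum (Multiset.sumAddMonoidHom : Multiset G →+ G) V).symm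
    rw [← this, hVU, ← map_multiset_sum, hU0, map_zero]
  · have : Multiset.card V.sum = (V.map Multiset.card).sum :=
      map_multiset_sum (Multiset.cardHom : Multiset G →+ ℕ) V
    rw [this, Multiset.map_congr rfl (g := fun _ => m)
      (fun b hb => (hB b (Multiset.mem_of_le hV hb)).1), Multiset.map_const',
      Multiset.sum_replicate, hVc, smul_eq_mul, mul_comm]

/-- If every zero-sum block of `T^{m-1}β` leaves a sequence of the form `T'^{m-1}`, then the block
`β` is `t^m` for some `t` in `T`. -/
theorem exists_eq_replicate_of_block {m r : ℕ} (hm : 2 ≤ m) (hexp : ∀ x : H, m • x = 0)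
    (hext : ∀ S : Multiset H, r * (m - 1) < Multiset.card S → ¬ NoZeroSum m S)
    {T β : Multiset H} (hT : NoZeroSum m ((m - 1) • T)) (hTc : Multiset.card T = r)
    (hβ : Multiset.card β = m) (hβ0 : β.sum = 0)
    (hrest : ∀ u w, u + w = β + (m - 1) • T → Multiset.card u = m → u.sum = 0 →
      ∃ T' : Multiset H, T'.Nodup ∧ w = (m - 1) • T') :
    ∃ t ∈ T, β = Multiset.replicate m t := by
  classical
  have hTn := hT.nodup hm hexp
  have hpred : ∀ x y : H, x + (m - 1) • y = 0 → x = y := by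
    intro x y h
    have e : (m - 1) • y + y = 0 := by
      rw [← succ_nsmul, Nat.sub_add_cancel (by omega), hexp]
    exact add_right_cancel ((h.trans e.symm).trans (add_comm _ _) : x + (m - 1) • y = y + _)
  have hsub : ∀ y ∈ β, y ∈ T := by
    intro y hy
    by_contra hyT
    by_cases hex : ∃ t ∈ β, t ∈ T
    · obtain ⟨t, htβ, htT⟩ := hex
      have hyt : y ≠ t := by rintro rfl; exact hyT htT
      have hle : Multiset.replicate m t ≤ β + (m - 1) • T := by
        rw [← Multiset.le_count_iff_replicate_le, Multiset.count_add, Multiset.count_nsmul,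
          Multiset.count_eq_one_of_mem hTn htT]
        have := Multiset.one_le_count_iff_mem.2 htβ
        omega
      obtain ⟨w, hw⟩ := Multiset.le_iff_exists_add.1 hle
      obtain ⟨T', -, rfl⟩ := hrest _ w hw.symm (by simp) (by simp [hexp])
      have h1 := congrArg (Multiset.count y) hw
      simp only [Multiset.count_add, Multiset.count_nsmul, Multiset.count_replicate,
        Multiset.count_eq_zero_of_notMem hyT, if_neg hyt.symm] at h1
      have h2 := Multiset.one_le_count_iff_mem.2 hy
      have h3 : m - 1 ≤ β.count y := by
        rcases Nat.eq_zero_or_pos (T'.count y) with h | h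
        · rw [h] at h1; omega
        · have : (m - 1) * 1 ≤ (m - 1) * T'.count y := Nat.mul_le_mul_left _ h
          omega
      have h4 : t ::ₘ Multiset.replicate (m - 1) y = β := by
        apply Multiset.eq_of_le_of_card_le
        · rw [Multiset.le_iff_count]
          intro z
          rw [Multiset.count_cons, Multiset.count_replicate]
          have := Multiset.one_le_count_iff_mem.2 htβ
          by_cases hzy : y = z
          · subst hzy; simp [hyt]; omega
          · by_cases hzt : z = t
            · subst hzt; simp [hyt]; omega
            · simp [hzy, hzt]
        · simp [hβ]; omega
      rw [← h4, Multiset.sum_cons, Multiset.sum_replicate] at hβ0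
      exact hyt (hpred _ _ hβ0).symm
    · push Not at hex
      obtain ⟨u, hu, hu0, huc⟩ := not_not.1 (hext (y ::ₘ (m - 1) • T) (by
        rw [Multiset.card_cons, Multiset.card_nsmul, hTc, mul_comm r]
        exact Nat.lt_succ_self _))
      have hyu : y ∈ u := by
        by_contra h
        exact hT ⟨u, (Multiset.le_cons_of_notMem h).1 hu, hu0, huc⟩
      obtain ⟨u', rfl⟩ := Multiset.exists_cons_of_mem hyu
      have hu' := (Multiset.cons_le_cons_iff y).1 hu
      have hle : y ::ₘ u' ≤ β + (m - 1) • T := by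
        rw [← Multiset.singleton_add]
        exact add_le_add (Multiset.singleton_le.2 hy) hu'
      obtain ⟨w, hw⟩ := Multiset.le_iff_exists_add.1 hle
      obtain ⟨T', hT', rfl⟩ := hrest _ w hw.symm huc hu0
      rw [Multiset.card_cons] at huc
      have hu'pos : 0 < Multiset.card u' := by omega
      obtain ⟨t, ht⟩ := Multiset.card_pos_iff_exists_mem.1 hu'pos
      have htT : t ∈ T := Multiset.mem_of_mem_nsmul (Multiset.mem_of_le hu' ht)
      have hyt : y ≠ t := by rintro rfl; exact hyT htT
      have htβ : t ∉ β := fun h => hex t h htT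
      have h1 := congrArg (Multiset.count t) hw
      simp only [Multiset.count_add, Multiset.count_nsmul, Multiset.count_cons,
        Multiset.count_eq_zero_of_notMem htβ, Multiset.count_eq_one_of_mem hTn htT,
        if_neg hyt.symm] at h1
      have h2 := Multiset.one_le_count_iff_mem.2 ht
      have h3 : m - 1 ≤ u'.count t := by
        rcases Nat.eq_zero_or_pos (T'.count t) with h | h
        · rw [h] at h1; omega
        · have : (m - 1) * 1 ≤ (m - 1) * T'.count t := Nat.mul_le_mul_left _ h
          omega
      have h4 : Multiset.replicate (m - 1) t = u' :=
        Multiset.eq_of_le_of_card_le (Multiset.le_count_iff_replicate_le.1 h3) (by simp; omega)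
      rw [← h4, Multiset.sum_cons, Multiset.sum_replicate] at hu0
      exact hyt (hpred _ _ hu0)
  obtain ⟨t, ht⟩ : ∃ t, m ≤ β.count t := by
    by_contra! hlt
    refine hT ⟨β, ?_, hβ0, hβ⟩
    rw [Multiset.le_iff_count]
    intro z
    rw [Multiset.count_nsmul]
    by_cases hz : z ∈ β
    · rw [Multiset.count_eq_one_of_mem hTn (hsub z hz)]
      have := hlt z
      omega
    · simp [Multiset.count_eq_zero_of_notMem hz]
  have hβe : Multiset.replicate m t = β :=
    Multiset.eq_of_le_of_card_le (Multiset.le_count_iff_replicate_le.1 ht) (by simp [hβ])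
  exact ⟨t, hsub t (by rw [← hβe]; exact Multiset.mem_replicate.2 ⟨by omega, rfl⟩), hβe.symm⟩

theorem exists_extremal_structure (φ : G →+ H) {m r q : ℕ} (hm : 2 ≤ m) (hq : 2 ≤ q)
    (hexp : ∀ x : H, m • x = 0)
    (hext : ∀ S : Multiset H, r * (m - 1) < Multiset.card S → ¬ NoZeroSum m S)
    (hD : ∀ S : Multiset H, Multiset.card S = r * (m - 1) → NoZeroSum m S →
      ∃ T : Multiset H, Multiset.card T = r ∧ S = (m - 1) • T)
    (hK : InverseEGZ q) (ι : ZMod q →+ G) (hι : Function.Injective ι)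
    (hker : ∀ g, φ g = 0 → ∃ k, ι k = g) {S : Multiset G}
    (hcard : Multiset.card S = r * (m - 1) + (2 * q - 2) * m) (hS : NoZeroSum (m * q) S) :
    ∃ (R X : Multiset G) (T : Multiset H) (a b : ZMod q), S = R + m • X ∧
      R.map φ = (m - 1) • T ∧ Multiset.card T = r ∧ Multiset.card X = 2 * q - 2 ∧
      NoZeroSum m ((m - 1) • T) ∧ (∀ x ∈ X, φ x ∈ T) ∧
      (∀ x ∈ X, ∀ y ∈ R, φ x = φ y → x = y) ∧
      X.map (fun x => m • x) =
        (Multiset.replicate (q - 1) a + Multiset.replicate (q - 1) b).map ι ∧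
      NoZeroSum q (Multiset.replicate (q - 1) a + Multiset.replicate (q - 1) b) := by
  classical
  obtain ⟨B, R, hBR, hBc, hB⟩ := exists_blocks φ (by omega) hext (2 * q - 2) S hcard
  have good : ∀ (B : Multiset (Multiset G)) (R : Multiset G), B.sum + R = S →
      Multiset.card B = 2 * q - 2 → (∀ b ∈ B, Multiset.card b = m ∧ φ b.sum = 0) →
      ∃ T : Multiset H, Multiset.card T = r ∧ R.map φ = (m - 1) • T ∧
        NoZeroSum m ((m - 1) • T) := by
    intro B R hBR hBc hB
    have hR : NoZeroSum m (R.map φ) := by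
      rintro ⟨U, hU, hU0, hUc⟩
      obtain ⟨V, hV, rfl⟩ := Multiset.exists_le_map_eq φ R U hU
      rw [Multiset.card_map] at hUc
      obtain ⟨M, hM, hM0⟩ := exists_block_sums φ ι hker hS (B := V ::ₘ B)
        (by rw [Multiset.sum_cons, add_comm, ← hBR]; exact add_le_add le_rfl hV) (by
          intro b hb
          rcases Multiset.mem_cons.1 hb with rfl | hb
          · exact ⟨hUc, by rw [map_multiset_sum, hU0]⟩
          · exact hB b hb)
      have hMc : Multiset.card M = 2 * q - 2 + 1 := by
        rw [← Multiset.card_map ι M, hM, Multiset.card_map, Multiset.card_cons, hBc]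
      obtain ⟨U, h1, h2, h3⟩ := ZMod.erdos_ginzburg_ziv_multiset (n := q) M (by omega)
      exact hM0 ⟨U, h1, h3, h2⟩
    have hRc : Multiset.card R = r * (m - 1) := by
      have h1 := congrArg Multiset.card hBR
      have : Multiset.card B.sum = (B.map Multiset.card).sum :=
        map_multiset_sum (Multiset.cardHom : Multiset G →+ ℕ) B
      rw [Multiset.card_add, this, Multiset.map_congr rfl (g := fun _ => m)
        (fun b hb => (hB b hb).1), Multiset.map_const', Multiset.sum_replicate, hBc,
        smul_eq_mul, hcard] at h1
      omega
    obtain ⟨T, hT, hRT⟩ := hD (R.map φ) (by rw [Multiset.card_map, hRc]) hR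
    exact ⟨T, hT, hRT, hRT ▸ hR⟩
  obtain ⟨T, hTc, hRT, hT⟩ := good B R hBR hBc hB
  have key : ∀ b ∈ B, ∃ x, b = Multiset.replicate m x ∧ φ x ∈ T ∧ ∀ y ∈ R, φ x = φ y → x = y := by
    intro b hb
    obtain ⟨B₁, rfl⟩ := Multiset.exists_cons_of_mem hb
    have hb' := hB b hb
    -- replacing the block `b` by another block of `b + R`
    have swap : ∀ b' R', b' + R' = b + R → Multiset.card b' = m → φ b'.sum = 0 →
        (b' ::ₘ B₁).sum + R' = S ∧ ∀ c ∈ b' ::ₘ B₁, Multiset.card c = m ∧ φ c.sum = 0 := by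
      intro b' R' h h1 h2
      constructor
      · rw [← hBR, Multiset.sum_cons, Multiset.sum_cons, add_right_comm, h, add_right_comm]
      · intro c hc
        rcases Multiset.mem_cons.1 hc with rfl | hc
        · exact ⟨h1, h2⟩
        · exact hB c (Multiset.mem_cons_of_mem hc)
    rw [Multiset.card_cons] at hBc
    have sumeq : ∀ b' R', b' + R' = b + R → Multiset.card b' = m → φ b'.sum = 0 →
        b'.sum = b.sum := by
      intro b' R' h h1 h2
      obtain ⟨k', hk'⟩ := hker _ h2
      obtain ⟨k, hk⟩ := hker _ hb'.2
      obtain ⟨h3, h4⟩ := swap b' R' h h1 h2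
      obtain ⟨M', hM', hM0'⟩ := exists_block_sums φ ι hker hS (B := b' ::ₘ B₁)
        (h3 ▸ Multiset.le_add_right _ _) h4
      obtain ⟨M, hM, hM0⟩ := exists_block_sums φ ι hker hS (B := b ::ₘ B₁)
        (hBR ▸ Multiset.le_add_right _ _) hB
      have hkM : k ∈ M := by
        have : b.sum ∈ M.map ι := by rw [hM]; simp
        obtain ⟨k₁, hk₁, he⟩ := Multiset.mem_map.1 this
        rwa [← hι (he.trans hk.symm)]
      obtain ⟨N, rfl⟩ := Multiset.exists_cons_of_mem hkM
      rw [Multiset.map_cons, Multiset.map_cons, hk, Multiset.cons_inj_right] at hM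
      have hMk : M' = k' ::ₘ N := by
        apply Multiset.map_injective hι
        rw [hM', Multiset.map_cons, Multiset.map_cons, hM, hk']
      subst hMk
      have hNc : Multiset.card N = 2 * q - 3 := by
        rw [← Multiset.card_map ι N, hM, Multiset.card_map]; omega
      rw [← hk, ← hk', NoZeroSum.eq_of_cons hq hK hNc hM0' hM0]
    obtain ⟨t, htT, hbt⟩ := exists_eq_replicate_of_block hm hexp hext hT hTc (β := b.map φ)
      (by rw [Multiset.card_map, hb'.1]) (by rw [← map_multiset_sum, hb'.2]) (by
        intro u w huw huc hu0
        rw [← hRT, ← Multiset.map_add] at huw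
        obtain ⟨V, hV, rfl⟩ := Multiset.exists_le_map_eq φ (b + R) u
          (huw ▸ Multiset.le_add_right _ _)
        obtain ⟨W, hVW⟩ := Multiset.le_iff_exists_add.1 hV
        rw [hVW, Multiset.map_add] at huw
        have hw : w = W.map φ := add_left_cancel huw
        rw [Multiset.card_map] at huc
        obtain ⟨h3, h4⟩ := swap V W hVW.symm huc (by rw [map_multiset_sum, hu0])
        obtain ⟨T', -, hT', hT0⟩ := good _ _ h3 (by rw [Multiset.card_cons, hBc]) h4
        exact ⟨T', hT0.nodup hm hexp, hw.trans hT'⟩)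
    have hbt' : ∀ x ∈ b, φ x = t := by
      intro x hx
      have : φ x ∈ b.map φ := Multiset.mem_map_of_mem _ hx
      rw [hbt] at this
      exact Multiset.eq_of_mem_replicate this
    have exch : ∀ x ∈ b, ∀ y ∈ R, φ x = φ y → x = y := by
      intro x hx y hy hxy
      obtain ⟨b₁, rfl⟩ := Multiset.exists_cons_of_mem hx
      obtain ⟨R₁, rfl⟩ := Multiset.exists_cons_of_mem hy
      have h1 : Multiset.card b₁ + 1 = m := by simpa using hb'.1
      have h2 : φ x + φ b₁.sum = 0 := by simpa using hb'.2
      have := sumeq (y ::ₘ b₁) (x ::ₘ R₁) (by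
        simp only [← Multiset.singleton_add]; abel) (by simpa using h1)
        (by simpa [hxy] using h2)
      simp only [Multiset.sum_cons] at this
      exact (add_right_cancel this).symm
    obtain ⟨y, hyR, hyt⟩ : ∃ y ∈ R, φ y = t := by
      apply Multiset.mem_map.1
      rw [hRT, Multiset.mem_nsmul]
      exact ⟨by omega, htT⟩
    refine ⟨y, ?_, hyt ▸ htT, ?_⟩
    · rw [← hb'.1]
      exact Multiset.eq_replicate_card.2 fun x hx => exch x hx y hyR (by rw [hbt' x hx, hyt])
    · obtain ⟨x, hx⟩ := Multiset.card_pos_iff_exists_mem.1 (by rw [hb'.1]; omega : 0 < Multiset.card b)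
      have hxy := exch x hx y hyR (by rw [hbt' x hx, hyt])
      intro z hz h
      rw [← hxy]
      exact exch x hx z hz (by rw [hxy, h])
  obtain ⟨X, hX, hXP⟩ := Multiset.exists_eq_map (Multiset.replicate m)
    (fun x => φ x ∈ T ∧ ∀ y ∈ R, φ x = φ y → x = y) B key
  obtain ⟨M, hM, hM0⟩ := exists_block_sums φ ι hker hS (B := B)
    (hBR ▸ Multiset.le_add_right _ _) hB
  have hMX : M.map ι = X.map (fun x => m • x) := by
    rw [hM, hX, Multiset.map_map]
    simp
  have hXc : Multiset.card X = 2 * q - 2 := by rw [← hBc, hX, Multiset.card_map]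
  obtain ⟨a, b, rfl⟩ := hK M
    (by rw [← Multiset.card_map ι, hMX, Multiset.card_map, hXc]) hM0
  exact ⟨R, X, T, a, b, by rw [← hBR, hX, Multiset.sum_map_replicate, add_comm], hRT, hTc, hXc, hT,
    fun x hx => (hXP x hx).1, fun x hx => (hXP x hx).2, hMX.symm, hM0⟩

end Blocks

theorem ZMod.zmultiplesHom_mul_eq_zero (m n : ℕ) :
    zmultiplesHom (ZMod (m * n)) (m : ZMod (m * n)) n = 0 := by
  rw [zmultiplesHom_apply, natCast_zsmul, nsmul_eq_mul, ← Nat.cast_mul, mul_comm n m,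
    ZMod.natCast_self]

/-- Multiplication by `m`, as an embedding of `ZMod n` into `ZMod (m * n)`. -/
def ZMod.mulEmbedding (m n : ℕ) : ZMod n →+ ZMod (m * n) :=
  ZMod.lift n ⟨zmultiplesHom _ (m : ZMod (m * n)), ZMod.zmultiplesHom_mul_eq_zero m n⟩

theorem ZMod.mulEmbedding_natCast (m n k : ℕ) :
    ZMod.mulEmbedding m n (k : ZMod n) = ((m * k : ℕ) : ZMod (m * n)) := by
  have := ZMod.lift_coe n ⟨zmultiplesHom _ (m : ZMod (m * n)),
    ZMod.zmultiplesHom_mul_eq_zero m n⟩ (k : ℤ)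
  rw [Int.cast_natCast] at this
  rw [ZMod.mulEmbedding, this]
  simp [mul_comm]

theorem ZMod.mulEmbedding_injective {m n : ℕ} (hm : 0 < m) (hn : 0 < n) :
    Function.Injective (ZMod.mulEmbedding m n) := by
  have : NeZero n := ⟨hn.ne'⟩
  rw [injective_iff_map_eq_zero]
  intro a ha
  rw [← ZMod.natCast_zmod_val a, ZMod.mulEmbedding_natCast, ZMod.natCast_eq_zero_iff] at ha
  rw [← ZMod.natCast_zmod_val a, ZMod.natCast_eq_zero_iff]
  exact Nat.dvd_of_mul_dvd_mul_left hm ha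

theorem ZMod.exists_mulEmbedding_eq {m n : ℕ} (hm : 0 < m) (hn : 0 < n) (g : ZMod (m * n))
    (hg : ZMod.castHom (dvd_mul_right m n) (ZMod m) g = 0) : ∃ k, ZMod.mulEmbedding m n k = g := by
  have : NeZero (m * n) := ⟨(Nat.mul_pos hm hn).ne'⟩
  rw [← ZMod.natCast_zmod_val g, map_natCast, ZMod.natCast_eq_zero_iff] at hg
  obtain ⟨k, hk⟩ := hg
  refine ⟨k, ?_⟩
  rw [ZMod.mulEmbedding_natCast, ← hk, ZMod.natCast_zmod_val]

theorem InverseEGZ.prime_mul {p q : ℕ} (hp : p.Prime) (hq : 2 ≤ q) (hK : InverseEGZ q) :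
    InverseEGZ (p * q) := by
  have hp2 := hp.two_le
  intro S hS hno
  obtain ⟨R, X, T, -, -, hSRX, hRT, hTc, hXc, -, hXT, hXR, -, -⟩ :=
    exists_extremal_structure (ZMod.castHom (dvd_mul_right p q) (ZMod p)).toAddMonoidHom
      (m := p) (r := 2) (q := q) hp2 hq (by simp)
      (fun S hS h => by
        obtain ⟨U, h1, h2, h3⟩ := ZMod.erdos_ginzburg_ziv_multiset (n := p) S (by omega)
        exact h ⟨U, h1, h3, h2⟩)
      (fun S hS h => by
        obtain ⟨a, b, rfl⟩ := InverseEGZ.of_prime hp S (by omega) h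
        exact ⟨{a, b}, rfl, by
          rw [Multiset.insert_eq_cons, ← Multiset.singleton_add, nsmul_add,
            Multiset.nsmul_singleton, Multiset.nsmul_singleton]⟩)
      hK (ZMod.mulEmbedding p q) (ZMod.mulEmbedding_injective (by omega) (by omega))
      (ZMod.exists_mulEmbedding_eq (by omega) (by omega)) (S := S) (by
        rw [hS, Nat.sub_mul, mul_comm p q, mul_assoc]
        have : 2 * p ≤ q * p := Nat.mul_le_mul_right _ hq
        omega) hno
  set φ := (ZMod.castHom (dvd_mul_right p q) (ZMod p)).toAddMonoidHom
  have hcnt : ∀ x, S.count x < p * q := NoZeroSum.count_lt hno (by simp)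
  have hRfib : ∀ t ∈ T, ∃ y ∈ R, φ y = t := fun t ht => Multiset.mem_map.1 (by
    rw [hRT, Multiset.mem_nsmul]; exact ⟨by omega, ht⟩)
  have hRmem : ∀ y ∈ R, φ y ∈ T := fun y hy => Multiset.mem_of_mem_nsmul (n := p - 1) (by
    rw [← hRT]; exact Multiset.mem_map_of_mem _ hy)
  have hXX : ∀ x ∈ X, ∀ x' ∈ X, φ x = φ x' → x = x' := by
    intro x hx x' hx' h
    obtain ⟨y, hy, hyx⟩ := hRfib _ (hXT x hx)
    rw [hXR x hx y hy hyx.symm, hXR x' hx' y hy (by rw [hyx, h])]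
  obtain ⟨t₁, t₂, rfl⟩ := Multiset.card_eq_two.1 hTc
  obtain ⟨x₁, hx₁⟩ : ∃ x, x ∈ X := Multiset.card_pos_iff_exists_mem.1 (by omega)
  have hne : ∃ x₂ ∈ X, φ x₂ ≠ φ x₁ := by
    by_contra! hall
    have hX : X = Multiset.replicate (2 * q - 2) x₁ :=
      Multiset.eq_replicate.2 ⟨hXc, fun b hb => hXX b hb x₁ hx₁ (hall b hb)⟩
    have h1 := hcnt x₁
    rw [hSRX, Multiset.count_add, Multiset.count_nsmul, hX, Multiset.count_replicate_self] at h1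
    have : p * q ≤ p * (2 * q - 2) := Nat.mul_le_mul_left _ (by omega)
    omega
  obtain ⟨x₂, hx₂, hx₂₁⟩ := hne
  have hfib : ∀ t ∈ ({t₁, t₂} : Multiset (ZMod p)), t = φ x₁ ∨ t = φ x₂ := by
    have h1 := hXT x₁ hx₁
    have h2 := hXT x₂ hx₂
    simp only [Multiset.insert_eq_cons, Multiset.mem_cons, Multiset.mem_singleton] at h1 h2 ⊢
    rintro t (rfl | rfl)
    · rcases h1 with h | h
      · exact Or.inl h.symm
      · rcases h2 with h' | h'
        · exact Or.inr h'.symm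
        · exact absurd (h'.trans h.symm) hx₂₁
    · rcases h1 with h | h
      · rcases h2 with h' | h'
        · exact absurd (h'.trans h.symm) hx₂₁
        · exact Or.inr h'.symm
      · exact Or.inl h.symm
  have hsupp : ∀ s ∈ S, s = x₁ ∨ s = x₂ := by
    intro s hs
    rw [hSRX, Multiset.mem_add] at hs
    rcases hs with hs | hs
    · exact (hfib _ (hRmem s hs)).imp (fun h => (hXR x₁ hx₁ s hs h.symm).symm)
        (fun h => (hXR x₂ hx₂ s hs h.symm).symm)
    · have hs := Multiset.mem_of_mem_nsmul hs
      exact (hfib _ (hXT s hs)).imp (fun h => hXX s hs x₁ hx₁ h) (fun h => hXX s hs x₂ hx₂ h)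
  have hx12 : x₁ ≠ x₂ := by rintro rfl; exact hx₂₁ rfl
  have hSe : S = Multiset.replicate (S.count x₁) x₁ + Multiset.replicate (S.count x₂) x₂ := by
    ext s
    rw [Multiset.count_add, Multiset.count_replicate, Multiset.count_replicate]
    by_cases h1 : x₁ = s
    · subst h1; simp [hx12.symm]
    · by_cases h2 : x₂ = s
      · subst h2; simp [h1]
      · rw [if_neg h1, if_neg h2, Multiset.count_eq_zero]
        intro h; rcases hsupp s h with h | h
        · exact h1 h.symm
        · exact h2 h.symm
  have hc := congrArg Multiset.card hSe
  rw [Multiset.card_add, Multiset.card_replicate, Multiset.card_replicate, hS] at hc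
  have h1 := hcnt x₁
  have h2 := hcnt x₂
  refine ⟨x₁, x₂, ?_⟩
  rw [show p * q - 1 = S.count x₁ by omega, show S.count x₁ = S.count x₂ by omega]
  rw [show S.count x₁ = S.count x₂ by omega] at hSe
  exact hSe

theorem InverseEGZ.of_pos {n : ℕ} (hn : 0 < n) : InverseEGZ n := by
  induction n using induction_on_primes with
  | zero => omega
  | one => exact fun S hS _ => ⟨0, 0, by simpa using hS⟩
  | prime_mul p a hp ih =>
    have ha : 0 < a := Nat.pos_of_mul_pos_left hn
    rcases Nat.lt_or_ge a 2 with h | h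
    · rw [show a = 1 by omega, mul_one]
      exact InverseEGZ.of_prime hp
    · exact InverseEGZ.prime_mul hp h (ih ha)

section PropertyD

variable {H : Type*} [AddCommGroup H]

theorem not_noZeroSum_of_lt_card [Fintype H] {m : ℕ} (hm : 2 ≤ m) (hexp : ∀ x : H, m • x = 0)
    (hH : Fintype.card H = m * m)
    (hD : ∀ S : Multiset H, Multiset.card S = 4 * (m - 1) → NoZeroSum m S →
      ∃ T, Multiset.card T = 4 ∧ S = (m - 1) • T)
    (S : Multiset H) (hS : 4 * (m - 1) < Multiset.card S) : ¬ NoZeroSum m S := by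
  classical
  intro h
  obtain ⟨S, hle, hcard⟩ := S.exists_le_of_le_card (Nat.succ_le_of_lt hS)
  replace h := h.mono hle
  by_cases hm2 : m = 2
  · subst hm2
    have hnd : S.Nodup := Multiset.nodup_iff_count_le_one.2 fun x =>
      Nat.le_of_lt_succ (h.count_lt hexp x)
    have := Finset.card_le_univ (⟨S, hnd⟩ : Finset H)
    simp only [Finset.card_mk, hcard, hH] at this
    omega
  obtain ⟨x, hx⟩ := Multiset.card_pos_iff_exists_mem.1 (by omega : 0 < Multiset.card S)
  obtain ⟨y, hy, hyx⟩ : ∃ y ∈ S, y ≠ x := by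
    by_contra! hall
    have := h.count_lt hexp x
    rw [Multiset.eq_replicate_card.2 hall, Multiset.count_replicate_self, hcard] at this
    omega
  have key : ∀ z ∈ S, ∃ T, S.erase z = (m - 1) • T := fun z hz => by
    obtain ⟨T, -, hT⟩ := hD (S.erase z) (by rw [Multiset.card_erase_of_mem hz, hcard]; rfl)
      (h.mono (Multiset.erase_le _ _))
    exact ⟨T, hT⟩
  obtain ⟨T, hT⟩ := key x hx
  obtain ⟨T', hT'⟩ := key y hy
  have h1 := congrArg (Multiset.count x) hT
  have h2 := congrArg (Multiset.count x) hT'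
  rw [Multiset.count_erase_self, Multiset.count_nsmul] at h1
  rw [Multiset.count_erase_of_ne hyx.symm, Multiset.count_nsmul] at h2
  have hpos := Multiset.count_pos.2 hx
  have : (m - 1) ∣ 1 := (Nat.dvd_add_right (Dvd.intro _ h1.symm)).1
    ⟨T'.count x, by rw [← h2]; omega⟩
  have := Nat.le_of_dvd one_pos this
  omega

/-- `a` and `b` are independent elements of order `m` (when `m` annihilates both). -/
def IndepMod (m : ℕ) (a b : H) : Prop :=
  ∀ i j : ℤ, i • a + j • b = 0 → (m : ℤ) ∣ i ∧ (m : ℤ) ∣ j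

theorem IndepMod.swap {m : ℕ} {a b : H} (h : IndepMod m a b) : IndepMod m b a := fun i j hij =>
  (h j i (by rwa [add_comm])).symm

theorem IndepMod.neg_left {m : ℕ} {a b : H} (h : IndepMod m a b) : IndepMod m (-a) b :=
  fun i j hij => by
    obtain ⟨h1, h2⟩ := h (-i) j (by rw [← hij]; module)
    exact ⟨(dvd_neg).1 h1, h2⟩

theorem IndepMod.add_zsmul {m : ℕ} {a b : H} (h : IndepMod m a b) (z : ℤ) :
    IndepMod m a (b + z • a) := fun i j hij => by
  obtain ⟨h1, h2⟩ := h (i + j * z) j (by rw [← hij]; module)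
  exact ⟨(dvd_add_left (h2.mul_right z)).1 h1, h2⟩

theorem IndepMod.exists_eq [Fintype H] {m : ℕ} (hH : Fintype.card H = m * m)
    {a b : H} (h : IndepMod m a b) (c : H) : ∃ u v : ℕ, u < m ∧ v < m ∧ c = u • a + v • b := by
  let f : Fin m × Fin m → H := fun p => (p.1 : ℕ) • a + (p.2 : ℕ) • b
  have hf : Function.Injective f := by
    rintro ⟨⟨u, hu⟩, ⟨v, hv⟩⟩ ⟨⟨u', hu'⟩, ⟨v', hv'⟩⟩ huv
    simp only [f] at huv
    obtain ⟨h1, h2⟩ := h ((u : ℤ) - u') ((v : ℤ) - v') (by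
      rw [sub_smul, sub_smul, natCast_zsmul, natCast_zsmul, natCast_zsmul, natCast_zsmul,
        sub_add_sub_comm, huv, sub_self])
    have e1 : u = u' := Nat.ModEq.eq_of_lt_of_lt
      ((Nat.modEq_iff_dvd.2 (by rw [← neg_sub, dvd_neg]; exact h1))) hu hu'
    have e2 : v = v' := Nat.ModEq.eq_of_lt_of_lt
      ((Nat.modEq_iff_dvd.2 (by rw [← neg_sub, dvd_neg]; exact h2))) hv hv'
    subst e1 e2
    rfl
  obtain ⟨⟨u, v⟩, huv⟩ := ((Fintype.bijective_iff_injective_and_card f).2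
    ⟨hf, by simp [hH]⟩).2 c
  exact ⟨u, v, u.2, v.2, huv.symm⟩

/-- No short nontrivial relation between `a`, `b`, `c`. -/
def NoShortRel (m : ℕ) (a b c : H) : Prop :=
  ∀ i j k : ℕ, i < m → j < m → k < m → 0 < i + j + k → i + j + k ≤ m →
    i • a + j • b + k • c ≠ 0

theorem NoZeroSum.noShortRel {m : ℕ} (hexp : ∀ x : H, m • x = 0) {t a b c : H}
    (h : NoZeroSum m ((m - 1) • ({t, t + a, t + b, t + c} : Multiset H))) :
    NoShortRel m a b c := by
  intro i j k hi hj hk h0 hle hsum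
  refine h ⟨Multiset.replicate (m - i - j - k) t + Multiset.replicate i (t + a) +
    Multiset.replicate j (t + b) + Multiset.replicate k (t + c), ?_, ?_, ?_⟩
  · have : (m - 1) • ({t, t + a, t + b, t + c} : Multiset H) =
        Multiset.replicate (m - 1) t + Multiset.replicate (m - 1) (t + a) +
        Multiset.replicate (m - 1) (t + b) + Multiset.replicate (m - 1) (t + c) := by
      simp only [Multiset.insert_eq_cons, ← Multiset.singleton_add, nsmul_add,
        Multiset.nsmul_singleton, add_assoc]
    rw [this]
    refine add_le_add (add_le_add (add_le_add ?_ ?_) ?_) ?_ <;>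
      exact (Multiset.replicate_le_replicate _).2 (by omega)
  · simp only [Multiset.sum_add, Multiset.sum_replicate, smul_add]
    rw [← hsum]
    have h1 : m • t = (m - i - j - k) • t + i • t + j • t + k • t := by
      rw [← add_smul, ← add_smul, ← add_smul]; congr 1; omega
    rw [hexp] at h1
    rw [← zero_add (i • a + _ + _), h1]
    abel
  · simp only [Multiset.card_add, Multiset.card_replicate]
    omega

theorem NoShortRel.rotate {m : ℕ} {a b c : H} (h : NoShortRel m a b c) : NoShortRel m c b a :=
  fun i j k hi hj hk h0 hle hs => h k j i hk hj hi (by omega) (by omega) (by rw [← hs]; abel)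

theorem NoShortRel.swap {m : ℕ} {a b c : H} (h : NoShortRel m a b c) : NoShortRel m b a c :=
  fun i j k hi hj hk h0 hle hs => h j i k hj hi hk (by omega) (by omega) (by rw [← hs]; abel)

theorem emod_toNat_smul {m : ℕ} {a : H} (ha : m • a = 0) (hm : 0 < m) (i : ℤ) :
    (i % m).toNat • a = i • a := by
  rw [← natCast_zsmul, Int.toNat_of_nonneg (Int.emod_nonneg _ (by omega))]
  conv_rhs => rw [← Int.emod_add_mul_ediv i m, add_smul, mul_comm, mul_smul, natCast_zsmul, ha,
    smul_zero, add_zero]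

theorem NoShortRel.indepMod {m : ℕ} (hm : 0 < m) {a b c : H} (h : NoShortRel m a b c)
    (ha : m • a = 0) (hb : m • b = 0) : IndepMod m a b := by
  intro i j hij
  rw [← emod_toNat_smul ha hm, ← emod_toNat_smul hb hm] at hij
  have hi : (i % m).toNat < m := by
    have := Int.emod_lt_of_pos i (by omega : (0 : ℤ) < m); omega
  have hj : (j % m).toNat < m := by
    have := Int.emod_lt_of_pos j (by omega : (0 : ℤ) < m); omega
  rw [Int.dvd_iff_emod_eq_zero, Int.dvd_iff_emod_eq_zero]
  have hi0 := Int.emod_nonneg i (by omega : (m : ℤ) ≠ 0)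
  have hj0 := Int.emod_nonneg j (by omega : (m : ℤ) ≠ 0)
  generalize hu : (i % m).toNat = u at *
  generalize hv : (j % m).toNat = v at *
  by_contra hne
  by_cases hle : u + v ≤ m
  · exact h u v 0 hi hj hm (by omega) (by omega) (by rw [hij, zero_smul, zero_add])
  · refine h (m - u) (m - v) 0 (by omega) (by omega) hm (by omega) (by omega) ?_
    have h1 : (m - u) • a + u • a = 0 := by rw [← add_smul, Nat.sub_add_cancel hi.le, ha]
    have h2 : (m - v) • b + v • b = 0 := by rw [← add_smul, Nat.sub_add_cancel hj.le, hb]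
    rw [zero_smul, add_zero, ← add_zero ((m - u) • a + _), ← hij, add_add_add_comm, h1, h2,
      add_zero]
    exact hij.symm

theorem nsmul_mod_of_nsmul_eq_zero {m : ℕ} {a : H} (ha : m • a = 0) (i : ℕ) :
    (i % m) • a = i • a := by
  conv_rhs => rw [← Nat.mod_add_div i m, add_smul, mul_comm, mul_smul, ha, smul_zero, add_zero]

theorem Nat.coprime_of_forall_mul_mod_ne_zero {m v : ℕ} (hm : 0 < m)
    (h : ∀ k, 1 ≤ k → k < m → k * v % m ≠ 0) : Nat.Coprime v m := by
  by_contra hne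
  have hpos : 0 < Nat.gcd v m := Nat.gcd_pos_of_pos_right _ hm
  have hgt : 1 < Nat.gcd v m := by
    have : Nat.gcd v m ≠ 1 := hne
    omega
  have hd := Nat.gcd_dvd_right v m
  refine h (m / Nat.gcd v m) (Nat.div_pos (Nat.le_of_dvd hm hd) hpos) (Nat.div_lt_self hm hgt) ?_
  obtain ⟨w, hw⟩ := Nat.gcd_dvd_left v m
  apply Nat.mod_eq_zero_of_dvd
  refine ⟨w, ?_⟩
  calc m / Nat.gcd v m * v = m / Nat.gcd v m * (Nat.gcd v m * w) := by rw [← hw]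
    _ = m * w := by rw [← mul_assoc, Nat.div_mul_cancel hd]

/-- The structure of extremal sequences without zero-sum subsequence of length `m` that are
`(m - 1)`-fold multiples. -/
theorem NoZeroSum.exists_vertices [Fintype H] {m : ℕ} (hm : 2 ≤ m) (hexp : ∀ x : H, m • x = 0)
    (hH : Fintype.card H = m * m) {T : Multiset H} (hT : Multiset.card T = 4)
    (h : NoZeroSum m ((m - 1) • T)) :
    ∃ (t₀ t₁ t₂ t₃ : H) (x : ℕ), T = {t₀, t₁, t₂, t₃} ∧ 1 ≤ x ∧ x < m ∧ Nat.Coprime x m ∧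
      x • (t₁ - t₀) + (t₃ - t₂) = 0 ∧ IndepMod m (t₁ - t₀) (t₂ - t₀) := by
  have hm0 : 0 < m := by omega
  obtain ⟨t, a', b', c', rfl⟩ := Multiset.card_eq_four.1 hT
  obtain ⟨a, rfl⟩ : ∃ a, a' = t + a := ⟨a' - t, by abel⟩
  obtain ⟨b, rfl⟩ : ∃ b, b' = t + b := ⟨b' - t, by abel⟩
  obtain ⟨c, rfl⟩ : ∃ c, c' = t + c := ⟨c' - t, by abel⟩
  have hs := h.noShortRel hexp
  have hab := hs.indepMod hm0 (hexp a) (hexp b)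
  have hcb := hs.rotate.indepMod hm0 (hexp c) (hexp b)
  have hca := (hs.swap.rotate).indepMod hm0 (hexp c) (hexp a)
  obtain ⟨u, v, hu, hv, huv⟩ := hab.exists_eq hH (-c)
  have hrel : ∀ k : ℕ, (k * u % m) • a + (k * v % m) • b + k • c = 0 := fun k => by
    have : c = -(u • a + v • b) := by rw [← huv, neg_neg]
    rw [nsmul_mod_of_nsmul_eq_zero (hexp a), nsmul_mod_of_nsmul_eq_zero (hexp b), this]
    module
  have hnd : ∀ k, 1 ≤ k → k < m → ¬ (m : ℤ) ∣ k := fun k h1 h2 hd => by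
    have := Nat.le_of_dvd h1 (Int.natCast_dvd_natCast.1 hd)
    omega
  have hu0 : ∀ k, 1 ≤ k → k < m → k * u % m ≠ 0 := fun k h1 h2 h0 => by
    have := hrel k
    rw [h0, zero_smul, zero_add] at this
    exact hnd k h1 h2 (hcb k (k * v % m : ℕ) (by rw [natCast_zsmul, natCast_zsmul, add_comm, this])).1
  have hv0 : ∀ k, 1 ≤ k → k < m → k * v % m ≠ 0 := fun k h1 h2 h0 => by
    have := hrel k
    rw [h0, zero_smul, add_zero] at this
    exact hnd k h1 h2 (hca k (k * u % m : ℕ) (by rw [natCast_zsmul, natCast_zsmul, add_comm, this])).1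
  have hwhite := white_arithmetic hm hu hv hu0 hv0 fun k h1 h2 => by
    have lu := Nat.mod_lt (k * u) hm0
    have lv := Nat.mod_lt (k * v) hm0
    have pu := hu0 k h1 h2
    have pv := hv0 k h1 h2
    constructor
    · by_contra hle
      exact hs _ _ _ lu lv h2 (by omega) (by omega) (hrel k)
    · by_contra hle
      refine hs (m - k * u % m) (m - k * v % m) (m - k) (by omega) (by omega) (by omega)
        (by omega) (by omega) ?_
      have e1 : (m - k * u % m) • a + (k * u % m) • a = 0 := by
        rw [← add_smul, Nat.sub_add_cancel lu.le, hexp]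
      have e2 : (m - k * v % m) • b + (k * v % m) • b = 0 := by
        rw [← add_smul, Nat.sub_add_cancel lv.le, hexp]
      have e3 : (m - k) • c + k • c = 0 := by
        rw [← add_smul, Nat.sub_add_cancel h2.le, hexp]
      rw [← add_zero (_ + (m - k) • c), ← hrel k, add_add_add_comm, add_add_add_comm _ _
        ((k * u % m) • a), e1, e2, e3, add_zero, add_zero]
      exact (hrel k).symm
  have hu1 : 1 ≤ u := by
    have := hu0 1 le_rfl (by omega)
    rw [one_mul, Nat.mod_eq_of_lt hu] at this; omega
  have hv1 : 1 ≤ v := by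
    have := hv0 1 le_rfl (by omega)
    rw [one_mul, Nat.mod_eq_of_lt hv] at this; omega
  have hcu := Nat.coprime_of_forall_mul_mod_ne_zero hm0 hu0
  have hcv := Nat.coprime_of_forall_mul_mod_ne_zero hm0 hv0
  have hc : u • a + v • b + c = 0 := by rw [← huv, neg_add_cancel]
  rcases hwhite with h1 | h1 | h1
  · refine ⟨t, t + b, t + a, t + c, v, ?_, hv1, hv, hcv, ?_, ?_⟩
    · simp only [Multiset.insert_eq_cons, Multiset.cons_swap (t + a) (t + b)]
    · have := hexp a
      rw [← h1] at this
      linear_combination (norm := module) hc - this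
    · simpa using hab.swap
  · refine ⟨t, t + a, t + b, t + c, u, rfl, hu1, hu, hcu, ?_, ?_⟩
    · have := hexp b
      rw [← h1] at this
      linear_combination (norm := module) hc - this
    · simpa using hab
  · refine ⟨t + b, t + a, t, t + c, u, ?_, hu1, hu, hcu, ?_, ?_⟩
    · simp only [Multiset.insert_eq_cons, Multiset.cons_swap t (t + b),
        Multiset.cons_swap t (t + a), Multiset.cons_swap (t + a) (t + b)]
    · have := hexp b
      rw [← h1] at this
      linear_combination (norm := module) hc - this
    · have := ((hab.swap.neg_left).add_zsmul 1).swap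
      rw [one_smul] at this
      convert this using 1 <;> abel

end PropertyD

section Forms

variable {G H : Type*} [AddCommGroup G] [AddCommGroup H]

/-- The first form of an extremal sequence. -/
def FormA (m n : ℕ) (S : Multiset G) : Prop :=
  ∃ (e1 e2 g : G) (x : ℤ) (s t : ℕ),
    (∀ a b : ℤ, a • e1 + b • e2 = 0 → a • e1 = 0 ∧ b • e2 = 0) ∧
    AddSubgroup.closure ({e1, e2} : Set G) = ⊤ ∧
    addOrderOf e2 = m * n ∧ Int.gcd x m = 1 ∧
    1 ≤ s ∧ s ≤ n ∧ 1 ≤ t ∧ t ≤ n ∧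
    S = Multiset.replicate (t * m - 1) g +
          Multiset.replicate ((n + 1 - t) * m - 1) (e1 + g) +
          Multiset.replicate (s * m - 1) (e2 + g) +
          Multiset.replicate ((n + 1 - s) * m - 1) ((-x) • e1 + e2 + g)

/-- The second form of an extremal sequence. -/
def FormB (m n : ℕ) (S : Multiset G) : Prop :=
  ∃ g1 g2 g : G,
    AddSubgroup.closure ({g1, g2} : Set G) = ⊤ ∧
    addOrderOf g2 = m * n ∧
    S = Multiset.replicate (m * n - 1) g +
          Multiset.replicate (m - 1) (g1 + g) +
          Multiset.replicate (m * n - 1) (g2 + g) +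
          Multiset.replicate (m - 1) (-g1 + g2 + g)

/-- The sequence `∏ gᵢ ^ (m - 1 + m xᵢ)`. -/
def quadSeq (m : ℕ) (G₀ G₁ G₂ G₃ : G) (x₀ x₁ x₂ x₃ : ℕ) : Multiset G :=
  Multiset.replicate (m - 1 + m * x₀) G₀ + Multiset.replicate (m - 1 + m * x₁) G₁ +
    Multiset.replicate (m - 1 + m * x₂) G₂ + Multiset.replicate (m - 1 + m * x₃) G₃

theorem Multiset.eq_of_replicate_add_replicate {A : Type*} {a b c d : A} {p q N : ℕ} (hN : 1 ≤ N)
    (hcd : c ≠ d) (h : replicate p a + replicate q b = replicate N c + replicate N d) :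
    p = N ∧ q = N ∧ (a = c ∧ b = d ∨ a = d ∧ b = c) := by
  classical
  have hc := congrArg (count c) h
  have hd := congrArg (count d) h
  have hs := congrArg card h
  simp only [count_add, count_replicate, card_add, card_replicate, if_true, if_neg hcd,
    if_neg hcd.symm] at hc hd hs
  grind

variable (φ : G →+ H) {m n : ℕ} (ι : ZMod n →+ G)

theorem addOrderOf_eq_mul_of_ker (hι : Function.Injective ι) {E F : G}
    (hind : IndepMod m (φ E) (φ F)) {d : ZMod n} (hF : m • F = ι d)
    (hd : ∀ z : ZMod n, ∃ i : ℕ, z = i • d) : addOrderOf F = m * n := by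
  refine Nat.dvd_antisymm (addOrderOf_dvd_of_nsmul_eq_zero ?_) ?_
  · rw [mul_comm, mul_smul, hF, ← map_nsmul, nsmul_eq_mul, ZMod.natCast_self, zero_mul, map_zero]
  · have h0 := addOrderOf_nsmul_eq_zero F
    obtain ⟨l, hl⟩ : m ∣ addOrderOf F := by
      have := congrArg φ h0
      rw [map_nsmul, map_zero] at this
      exact Int.natCast_dvd_natCast.1 (hind 0 (addOrderOf F : ℕ)
        (by rw [zero_smul, zero_add, natCast_zsmul, this])).2
    rw [hl] at h0 ⊢
    rw [mul_comm, mul_smul, hF, ← map_nsmul] at h0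
    have h1 : l • d = 0 := hι (by rw [h0, map_zero])
    obtain ⟨i, hi⟩ := hd 1
    have : (l : ZMod n) = 0 := by
      rw [← mul_one (l : ZMod n), ← nsmul_eq_mul, hi, smul_comm, h1, smul_zero]
    exact mul_dvd_mul_left m ((ZMod.natCast_eq_zero_iff l n).1 this)

theorem closure_pair_eq_top_of_ker [Fintype H] (hH : Fintype.card H = m * m)
    (hker : ∀ g, φ g = 0 → ∃ k, ι k = g) {E F : G}
    (hind : IndepMod m (φ E) (φ F)) {d : ZMod n} (hF : m • F = ι d)
    (hd : ∀ z : ZMod n, ∃ i : ℕ, z = i • d) : AddSubgroup.closure ({E, F} : Set G) = ⊤ := by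
  rw [eq_top_iff]
  rintro g -
  have hE' : E ∈ AddSubgroup.closure ({E, F} : Set G) := AddSubgroup.subset_closure (by simp)
  have hF' : F ∈ AddSubgroup.closure ({E, F} : Set G) := AddSubgroup.subset_closure (by simp)
  obtain ⟨u, v, -, -, huv⟩ := hind.exists_eq hH (φ g)
  obtain ⟨k, hk⟩ := hker (g - (u • E + v • F)) (by simp [huv])
  obtain ⟨i, rfl⟩ := hd k
  rw [map_nsmul, ← hF] at hk
  rw [← sub_add_cancel g (u • E + v • F), ← hk]
  exact add_mem (nsmul_mem (nsmul_mem hF' _) _) (add_mem (nsmul_mem hE' _) (nsmul_mem hF' _))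

variable {φ ι}

theorem formA_quadSeq [Fintype H] (hm : 0 < m) (hn : 0 < n) (hH : Fintype.card H = m * m)
    (hι : Function.Injective ι) (hker : ∀ g, φ g = 0 → ∃ k, ι k = g)
    {G₀ G₁ G₂ G₃ : G} (hind : IndepMod m (φ (G₁ - G₀)) (φ (G₂ - G₀))) {d : ZMod n}
    (hF : m • (G₂ - G₀) = ι d) (hd : ∀ z : ZMod n, ∃ i : ℕ, z = i • d)
    (hE : m • (G₁ - G₀) = 0) {x : ℕ} (hx : Nat.Coprime x m)
    (hG₃ : x • (G₁ - G₀) + (G₃ - G₂) = 0) {x₀ x₁ x₂ x₃ : ℕ}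
    (h01 : x₀ + x₁ = n - 1) (h23 : x₂ + x₃ = n - 1) :
    FormA m n (quadSeq m G₀ G₁ G₂ G₃ x₀ x₁ x₂ x₃) := by
  refine ⟨G₁ - G₀, G₂ - G₀, G₀, x, x₂ + 1, x₀ + 1, ?_,
    closure_pair_eq_top_of_ker φ ι hH hker hind hF hd,
    addOrderOf_eq_mul_of_ker φ ι hι hind hF hd, by simpa using hx,
    by omega, by omega, by omega, by omega, ?_⟩
  · intro a b hab
    have h1 := congrArg φ hab
    rw [map_add, map_zsmul, map_zsmul, map_zero] at h1
    obtain ⟨⟨k, rfl⟩, -⟩ := hind a b h1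
    have : ((m : ℤ) * k) • (G₁ - G₀) = 0 := by
      rw [mul_comm, mul_smul, natCast_zsmul, hE, smul_zero]
    rw [this, zero_add] at hab
    exact ⟨this, hab⟩
  · have e1 : ∀ y, m - 1 + m * y = (y + 1) * m - 1 := fun y => by
      rw [add_mul, one_mul, mul_comm y m]; omega
    have e2 : (-(x : ℤ)) • (G₁ - G₀) + (G₂ - G₀) + G₀ = G₃ := by
      rw [neg_smul, natCast_zsmul, neg_eq_of_add_eq_zero_right hG₃]; abel
    rw [e2, sub_add_cancel, sub_add_cancel, quadSeq, e1, e1, e1, e1,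
      (by omega : n + 1 - (x₀ + 1) = x₁ + 1), (by omega : n + 1 - (x₂ + 1) = x₃ + 1)]

theorem formB_quadSeq [Fintype H] (hm : 0 < m) (hn : 0 < n) (hH : Fintype.card H = m * m)
    (hι : Function.Injective ι) (hker : ∀ g, φ g = 0 → ∃ k, ι k = g)
    {G₀ G₁ G₂ G₃ : G} (hind : IndepMod m (φ (G₁ - G₀)) (φ (G₂ - G₀))) {d : ZMod n}
    (hF : m • (G₂ - G₀) = ι d) (hd : ∀ z : ZMod n, ∃ i : ℕ, z = i • d)
    (hG₃ : G₀ + G₂ = G₁ + G₃) :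
    FormB m n (quadSeq m G₀ G₁ G₂ G₃ (n - 1) 0 (n - 1) 0) := by
  refine ⟨G₁ - G₀, G₂ - G₀, G₀, closure_pair_eq_top_of_ker φ ι hH hker hind hF hd,
    addOrderOf_eq_mul_of_ker φ ι hι hind hF hd, ?_⟩
  have e1 : m - 1 + m * (n - 1) = m * n - 1 := by
    obtain ⟨k, rfl⟩ : ∃ k, n = k + 1 := ⟨n - 1, by omega⟩
    rw [Nat.add_sub_cancel, mul_add, mul_one]; omega
  have e2 : -(G₁ - G₀) + (G₂ - G₀) + G₀ = G₃ := by
    rw [← sub_eq_iff_eq_add'] at hG₃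
    rw [← hG₃]; abel
  rw [e2, sub_add_cancel, sub_add_cancel, quadSeq, e1, mul_zero, add_zero]

theorem formA_of_nsmul_eq [Fintype H] (hm : 0 < m) (hn : 2 ≤ n) (hH : Fintype.card H = m * m)
    (hι : Function.Injective ι) (hker : ∀ g, φ g = 0 → ∃ k, ι k = g)
    {h h' : ZMod n} (hh : ∀ z : ZMod n, ∃ i : ℕ, z = i • (h - h'))
    (hh' : ∀ z : ZMod n, ∃ i : ℕ, z = i • (h' - h)) (hne : h ≠ h')
    {G₀ G₁ G₂ G₃ : G} (hind : IndepMod m (φ (G₁ - G₀)) (φ (G₂ - G₀)))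
    {x : ℕ} (hx : Nat.Coprime x m) (hG₃ : x • (G₁ - G₀) + (G₃ - G₂) = 0) {x₀ x₁ x₂ x₃ : ℕ}
    (hX : Multiset.replicate x₀ (m • G₀) + Multiset.replicate x₁ (m • G₁) +
      Multiset.replicate x₂ (m • G₂) + Multiset.replicate x₃ (m • G₃) =
      Multiset.replicate (n - 1) (ι h) + Multiset.replicate (n - 1) (ι h'))
    (h01 : m • G₀ = m • G₁) (h23 : m • G₂ = m • G₃) :
    FormA m n (quadSeq m G₀ G₁ G₂ G₃ x₀ x₁ x₂ x₃) := by
  rw [← h01, ← h23, ← Multiset.replicate_add, add_assoc, ← Multiset.replicate_add] at hX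
  obtain ⟨e1, e2, e3⟩ := Multiset.eq_of_replicate_add_replicate (by omega) (hι.ne hne) hX
  have hE : m • (G₁ - G₀) = 0 := by rw [smul_sub, h01, sub_self]
  rcases e3 with ⟨e3, e4⟩ | ⟨e3, e4⟩
  · exact formA_quadSeq hm (by omega) hH hι hker hind
      (by rw [smul_sub, e3, e4, ← map_sub]) hh' hE hx hG₃ e1 e2
  · exact formA_quadSeq hm (by omega) hH hι hker hind
      (by rw [smul_sub, e3, e4, ← map_sub]) hh hE hx hG₃ e1 e2

theorem form_of_parallelogram [Fintype H] (hm : 0 < m) (hn : 2 ≤ n)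
    (hH : Fintype.card H = m * m)
    (hι : Function.Injective ι) (hker : ∀ g, φ g = 0 → ∃ k, ι k = g)
    {h h' : ZMod n} (hh : ∀ z : ZMod n, ∃ i : ℕ, z = i • (h - h'))
    (hh' : ∀ z : ZMod n, ∃ i : ℕ, z = i • (h' - h)) (hne : h ≠ h')
    {G₀ G₁ G₂ G₃ : G} (hind : IndepMod m (φ (G₁ - G₀)) (φ (G₂ - G₀)))
    (hG₃ : G₀ + G₂ = G₁ + G₃) (hsum : m • (G₀ + G₂) = ι h + ι h') {x₀ x₁ x₂ x₃ : ℕ}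
    (hX : Multiset.replicate x₀ (m • G₀) + Multiset.replicate x₁ (m • G₁) +
      Multiset.replicate x₂ (m • G₂) + Multiset.replicate x₃ (m • G₃) =
      Multiset.replicate (n - 1) (ι h) + Multiset.replicate (n - 1) (ι h')) :
    FormA m n (quadSeq m G₀ G₁ G₂ G₃ x₀ x₁ x₂ x₃) ∨
      FormB m n (quadSeq m G₀ G₁ G₂ G₃ x₀ x₁ x₂ x₃) := by
  have hsum' : m • (G₁ + G₃) = ι h + ι h' := by rw [← hG₃, hsum]
  rw [smul_add] at hsum hsum'
  by_cases h13 : x₁ = 0 ∧ x₃ = 0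
  · obtain ⟨rfl, rfl⟩ := h13
    simp only [Multiset.replicate_zero, add_zero] at hX
    obtain ⟨rfl, rfl, e3⟩ := Multiset.eq_of_replicate_add_replicate (by omega) (hι.ne hne) hX
    right
    rcases e3 with ⟨e3, e4⟩ | ⟨e3, e4⟩
    · exact formB_quadSeq hm (by omega) hH hι hker hind
        (by rw [smul_sub, e3, e4, ← map_sub]) hh' hG₃
    · exact formB_quadSeq hm (by omega) hH hι hker hind
        (by rw [smul_sub, e3, e4, ← map_sub]) hh hG₃
  by_cases h02 : x₀ = 0 ∧ x₂ = 0
  · obtain ⟨rfl, rfl⟩ := h02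
    simp only [Multiset.replicate_zero, add_zero, zero_add] at hX
    obtain ⟨rfl, rfl, e3⟩ := Multiset.eq_of_replicate_add_replicate (by omega) (hι.ne hne) hX
    right
    have hind' : IndepMod m (φ (G₀ - G₁)) (φ (G₃ - G₁)) := by
      have := hind.neg_left.add_zsmul 2
      rw [← map_neg, ← map_zsmul, ← map_add] at this
      convert this using 2
      · abel
      · rw [← sub_eq_iff_eq_add'] at hG₃
        rw [← hG₃]; module
    have hq : quadSeq m G₀ G₁ G₂ G₃ 0 (n - 1) 0 (n - 1) =
        quadSeq m G₁ G₀ G₃ G₂ (n - 1) 0 (n - 1) 0 := by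
      simp only [quadSeq]; abel
    rw [hq]
    rcases e3 with ⟨e3, e4⟩ | ⟨e3, e4⟩
    · exact formB_quadSeq hm (by omega) hH hι hker hind'
        (by rw [smul_sub, e3, e4, ← map_sub]) hh' hG₃.symm
    · exact formB_quadSeq hm (by omega) hH hι hker hind'
        (by rw [smul_sub, e3, e4, ← map_sub]) hh hG₃.symm
  left
  have hmem : ∀ y, y ∈ Multiset.replicate x₀ (m • G₀) + Multiset.replicate x₁ (m • G₁) +
      Multiset.replicate x₂ (m • G₂) + Multiset.replicate x₃ (m • G₃) → y = ι h ∨ y = ι h' := by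
    intro y hy
    rw [hX, Multiset.mem_add] at hy
    exact hy.imp Multiset.eq_of_mem_replicate Multiset.eq_of_mem_replicate
  simp only [Multiset.mem_add, Multiset.mem_replicate] at hmem
  have key : ∀ a b : G, a + b = ι h + ι h' → (a = ι h ∨ a = ι h') ∨ (b = ι h ∨ b = ι h') →
      a = ι h ∧ b = ι h' ∨ a = ι h' ∧ b = ι h := by
    rintro a b hab ((rfl | rfl) | (rfl | rfl))
    · exact Or.inl ⟨rfl, add_left_cancel hab⟩
    · exact Or.inr ⟨rfl, add_left_cancel (hab.trans (add_comm _ _))⟩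
    · exact Or.inr ⟨add_right_cancel (hab.trans (add_comm _ _)), rfl⟩
    · exact Or.inl ⟨add_right_cancel hab, rfl⟩
  have k02 := key _ _ hsum (by
    by_cases h0 : x₀ = 0
    · exact Or.inr (hmem _ (by tauto))
    · exact Or.inl (hmem _ (by tauto)))
  have k13 := key _ _ hsum' (by
    by_cases h0 : x₁ = 0
    · exact Or.inr (hmem _ (by tauto))
    · exact Or.inl (hmem _ (by tauto)))
  have hcase : m • G₀ = m • G₁ ∧ m • G₂ = m • G₃ ∨ m • G₀ = m • G₃ ∧ m • G₂ = m • G₁ := by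
    rcases k02 with ⟨a, b⟩ | ⟨a, b⟩ <;> rcases k13 with ⟨c, d⟩ | ⟨c, d⟩ <;> rw [a, b, c, d] <;> simp
  rcases hcase with ⟨a, b⟩ | ⟨a, b⟩
  · refine formA_of_nsmul_eq hm hn hH hι hker hh hh' hne hind (Nat.coprime_one_left m) ?_ hX a b
    rw [one_smul, sub_add_sub_comm, hG₃.symm, add_comm G₀, sub_self]
  · have hq : quadSeq m G₀ G₁ G₂ G₃ x₀ x₁ x₂ x₃ = quadSeq m G₀ G₃ G₂ G₁ x₀ x₃ x₂ x₁ := by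
      simp only [quadSeq]; abel
    rw [hq]
    have hind' : IndepMod m (φ (G₃ - G₀)) (φ (G₂ - G₀)) := by
      have := (hind.neg_left.swap.add_zsmul 1).swap
      rw [one_smul, ← map_neg, ← map_add] at this
      convert this using 2
      rw [← sub_eq_iff_eq_add'] at hG₃
      rw [← hG₃]; abel
    refine formA_of_nsmul_eq hm hn hH hι hker hh hh' hne hind' (Nat.coprime_one_left m) ?_ ?_ a b
    · rw [one_smul, sub_add_sub_comm, add_comm G₃, hG₃.symm, add_comm G₀, sub_self]
    · rw [← hX]; abel

end Forms

section Extremal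

variable {G H : Type*} [AddCommGroup G] [AddCommGroup H]

theorem nsmul_eq_zero_of_walk_of_lt {m x : ℕ} (hx2 : 2 ≤ x) (hxm : 2 * x < m)
    (hx : Nat.Coprime x m) {E D C : G}
    (hk : ∀ k y : ℕ, 1 ≤ k → k < m → 1 ≤ y → y < m → y ≡ k * x [MOD m] → y • E + k • D = C) :
    m • E = 0 ∧ x • E + D = 0 := by
  have h1 := hk 1 x le_rfl (by omega) (by omega) (by omega) (by rw [one_mul])
  have h2 := hk 2 (2 * x) (by omega) (by omega) (by omega) (by omega) rfl
  have h0 : x • E + D = 0 := by linear_combination (norm := module) h2 - h1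
  refine ⟨?_, h0⟩
  have hlt := Nat.lt_mul_div_succ m (by omega : 0 < x)
  have hle := Nat.mul_div_le m x
  have hne : x * (m / x) ≠ m := fun h => by
    have := hx.eq_one_of_dvd ⟨_, h.symm⟩
    omega
  have hdiv : m / x ≤ m / 2 := Nat.div_le_div_left hx2 (by omega)
  have hmul : x * (m / x + 1) = x * (m / x) + x := by ring
  obtain ⟨y, hy⟩ : ∃ y, x * (m / x + 1) = m + y := ⟨_, (Nat.add_sub_cancel' hlt.le).symm⟩
  have h3 := hk (m / x + 1) y (Nat.succ_pos _) (by omega) (by omega) (by omega) (by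
    rw [mul_comm, hy]; simp [Nat.ModEq])
  have hC : C = 0 := by rw [← h1, one_smul, h0]
  have h4 : (m / x + 1) • (x • E + D) = 0 := by rw [h0, smul_zero]
  rw [smul_add, smul_smul, mul_comm, hy, add_smul] at h4
  rw [hC] at h3
  linear_combination (norm := module) h4 - h3

theorem relation_of_walk {m x : ℕ} (hm : 3 ≤ m) (hx1 : 1 ≤ x) (hxm : x < m)
    (hx : Nat.Coprime x m) {E D C : G}
    (hk : ∀ k y : ℕ, 1 ≤ k → k < m → 1 ≤ y → y < m → y ≡ k * x [MOD m] → y • E + k • D = C) :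
    (m • E = 0 ∧ x • E + D = 0) ∨ (E + D = 0 ∧ C = 0) ∨ (D = E ∧ C = m • E) := by
  have h1 := hk 1 x le_rfl (by omega) (by omega) (by omega) (by rw [one_mul])
  rcases Nat.lt_trichotomy (2 * x) m with hlt | heq | hgt
  · rcases hx1.eq_or_lt with rfl | hx2
    · have h2 := hk 2 2 (by omega) (by omega) (by omega) (by omega) rfl
      have h0 : E + D = 0 := by linear_combination (norm := module) h2 - h1
      exact Or.inr (Or.inl ⟨h0, by rw [← h1, one_smul, one_smul, h0]⟩)
    · exact Or.inl (nsmul_eq_zero_of_walk_of_lt hx2 hlt hx hk)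
  · have := hx.eq_one_of_dvd ⟨2, by omega⟩
    omega
  · obtain ⟨x', rfl⟩ : ∃ x', m = x + x' := ⟨m - x, by omega⟩
    have hx' : Nat.Coprime x' (x + x') := by
      rw [Nat.coprime_add_self_right]
      exact (Nat.coprime_self_add_right.1 hx).symm
    rcases (by omega : 1 ≤ x').eq_or_lt with rfl | hx2
    · obtain ⟨w, rfl⟩ : ∃ w, x = w + 1 := ⟨x - 1, by omega⟩
      have h2 := hk 2 w (by omega) (by omega) (by omega) (by omega) (by
        rw [(by ring : 2 * (w + 1) = w + (w + 1 + 1))]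
        simp [Nat.ModEq])
      have h0 : D = E := by linear_combination (norm := module) h2 - h1
      refine Or.inr (Or.inr ⟨h0, ?_⟩)
      rw [← h1, h0]
      module
    · left
      obtain ⟨h3, h4⟩ := nsmul_eq_zero_of_walk_of_lt (m := x + x') (E := -E) (D := D)
        (C := C - (x + x') • E) hx2 (by omega) hx' (by
          intro k y hk1 hk2 hy1 hy2 hy
          have := hk k (x + x' - y) hk1 hk2 (by omega) (by omega) (by
            refine Nat.ModEq.add_right_cancel hy ?_
            rw [Nat.sub_add_cancel hy2.le, ← mul_add]
            simp [Nat.ModEq])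
          have h5 : (x + x' - y) • E + y • E = (x + x') • E := by
            rw [← add_smul, Nat.sub_add_cancel hy2.le]
          linear_combination (norm := module) this - h5)
      rw [smul_neg, neg_eq_zero] at h3
      exact ⟨h3, by linear_combination (norm := module) h4 + h3⟩

theorem Multiset.exists_eq_add_of_map_eq_add {A B : Type*} {f : A → B} {R : Multiset A}
    {U V : Multiset B} (h : R.map f = U + V) :
    ∃ R₁ R₂, R = R₁ + R₂ ∧ R₁.map f = U ∧ R₂.map f = V := by
  obtain ⟨R₁, hR, h1⟩ := Multiset.exists_le_map_eq f R U (h ▸ Multiset.le_add_right U V)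
  obtain ⟨R₂, rfl⟩ := Multiset.le_iff_exists_add.1 hR
  exact ⟨R₁, R₂, rfl, h1, by rw [Multiset.map_add, h1] at h; exact add_left_cancel h⟩

theorem Multiset.exists_eq_replicate_of_mem {A : Type*} {a b c d : A} (X : Multiset A) :
    (∀ x ∈ X, x = a ∨ x = b ∨ x = c ∨ x = d) → ∃ p q r s : ℕ,
      X = replicate p a + replicate q b + replicate r c + replicate s d := by
  induction X using Multiset.induction with
  | empty => exact fun _ => ⟨0, 0, 0, 0, by simp⟩
  | cons y X ih =>
    intro h
    obtain ⟨p, q, r, s, rfl⟩ := ih fun x hx => h x (mem_cons_of_mem hx)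
    rcases h y (mem_cons_self _ _) with rfl | rfl | rfl | rfl
    · exact ⟨p + 1, q, r, s, by rw [replicate_succ, cons_add, cons_add, cons_add]⟩
    · exact ⟨p, q + 1, r, s, by rw [replicate_succ, add_cons, cons_add, cons_add]⟩
    · exact ⟨p, q, r + 1, s, by rw [replicate_succ, add_cons, cons_add]⟩
    · exact ⟨p, q, r, s + 1, by rw [replicate_succ, add_cons]⟩

theorem exists_eq_replicate_of_swap {φ : G →+ H} {m : ℕ} {σ : G}
    {R₀ R₁ R₂ R₃ : Multiset G} {t₀ t₁ t₂ t₃ : H}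
    (h₀ : R₀.map φ = Multiset.replicate (m - 1) t₀) (h₁ : R₁.map φ = Multiset.replicate (m - 1) t₁)
    (h₂ : R₂.map φ = Multiset.replicate (m - 1) t₂) (h₃ : R₃.map φ = Multiset.replicate (m - 1) t₃)
    (hsum : ∀ z ≤ R₀ + R₁ + R₂ + R₃, Multiset.card z = 2 * m → φ z.sum = 0 → z.sum = σ)
    {c₁ c₂ c₃ : ℕ} (hc₁ : c₁ ≤ m - 1) (hc₂ : c₂ ≤ m - 1) (hc₃ : c₃ ≤ m - 1)
    (hc : 1 + c₁ + c₂ + c₃ = 2 * m) (ht : t₀ + c₁ • t₁ + c₂ • t₂ + c₃ • t₃ = 0) :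
    ∃ g, R₀ = Multiset.replicate (m - 1) g ∧ φ g = t₀ := by
  have aux : ∀ {R : Multiset G} {t : H} {c : ℕ}, R.map φ = Multiset.replicate (m - 1) t →
      c ≤ m - 1 → ∃ Q ≤ R, Multiset.card Q = c ∧ φ Q.sum = c • t := by
    intro R t c hR hc
    obtain ⟨Q, hQ, hQc⟩ := R.exists_le_of_le_card (k := c)
      (by rw [← Multiset.card_map φ, hR, Multiset.card_replicate]; exact hc)
    refine ⟨Q, hQ, hQc, ?_⟩
    rw [map_multiset_sum, ← hQc, ← Multiset.card_map φ, ← Multiset.sum_replicate]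
    congr 1
    refine Multiset.eq_replicate_card.2 fun y hy => ?_
    have := Multiset.mem_of_le (Multiset.map_le_map hQ) hy
    rw [hR] at this
    exact Multiset.eq_of_mem_replicate this
  obtain ⟨Q₁, hQ₁, hQc₁, hQs₁⟩ := aux h₁ hc₁
  obtain ⟨Q₂, hQ₂, hQc₂, hQs₂⟩ := aux h₂ hc₂
  obtain ⟨Q₃, hQ₃, hQc₃, hQs₃⟩ := aux h₃ hc₃
  have hcard : Multiset.card R₀ = m - 1 := by
    rw [← Multiset.card_map φ, h₀, Multiset.card_replicate]
  have hφ : ∀ g ∈ R₀, φ g = t₀ := fun g hg =>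
    Multiset.eq_of_mem_replicate (h₀ ▸ Multiset.mem_map_of_mem φ hg)
  have key : ∀ g ∈ R₀, g = σ - (Q₁.sum + Q₂.sum + Q₃.sum) := fun g hg => by
    have := hsum ({g} + Q₁ + Q₂ + Q₃)
      (add_le_add (add_le_add (add_le_add (Multiset.singleton_le.2 hg) hQ₁) hQ₂) hQ₃)
      (by simp only [Multiset.card_add, Multiset.card_singleton]; omega)
      (by simp only [Multiset.sum_add, Multiset.sum_singleton, map_add, hQs₁, hQs₂, hQs₃, hφ g hg,
        ht])
    rw [← this]
    simp only [Multiset.sum_add, Multiset.sum_singleton]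
    abel
  obtain ⟨g, hg⟩ := Multiset.card_pos_iff_exists_mem.1 (by omega : 0 < Multiset.card R₀)
  exact ⟨g, Multiset.eq_replicate.2 ⟨hcard, fun y hy => (key y hy).trans (key g hg).symm⟩, hφ g hg⟩

theorem exists_mul_modEq {m x : ℕ} (hm : 2 ≤ m) (hx : Nat.Coprime x m) :
    ∃ k, 1 ≤ k ∧ k < m ∧ 1 ≡ k * x [MOD m] := by
  obtain ⟨k, hk, h⟩ := Nat.exists_mul_mod_eq_one_of_coprime hx (by omega)
  refine ⟨k, Nat.pos_of_ne_zero ?_, hk, ?_⟩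
  · rintro rfl
    simp at h
  · rw [mul_comm, Nat.ModEq, h, Nat.mod_eq_of_lt (by omega)]

theorem form_of_quadSeq [Fintype H] {φ : G →+ H} {m n : ℕ} {ι : ZMod n →+ G} (hm : 2 ≤ m)
    (hn : 2 ≤ n) (hH : Fintype.card H = m * m)
    (hι : Function.Injective ι) (hker : ∀ g, φ g = 0 → ∃ k, ι k = g)
    {h h' : ZMod n} (hh : ∀ z : ZMod n, ∃ i : ℕ, z = i • (h - h'))
    (hh' : ∀ z : ZMod n, ∃ i : ℕ, z = i • (h' - h)) (hne : h ≠ h')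
    {G₀ G₁ G₂ G₃ : G} (hind : IndepMod m (φ (G₁ - G₀)) (φ (G₂ - G₀)))
    {x : ℕ} (hx1 : 1 ≤ x) (hxm : x < m) (hx : Nat.Coprime x m)
    (hG₃ : x • φ (G₁ - G₀) + φ (G₃ - G₂) = 0)
    (hk : ∀ k y : ℕ, 1 ≤ k → k < m → 1 ≤ y → y < m → y ≡ k * x [MOD m] →
      (m - y) • G₀ + y • G₁ + (m - k) • G₂ + k • G₃ = ι h + ι h') {x₀ x₁ x₂ x₃ : ℕ}
    (hX : Multiset.replicate x₀ (m • G₀) + Multiset.replicate x₁ (m • G₁) +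
      Multiset.replicate x₂ (m • G₂) + Multiset.replicate x₃ (m • G₃) =
      Multiset.replicate (n - 1) (ι h) + Multiset.replicate (n - 1) (ι h')) :
    FormA m n (quadSeq m G₀ G₁ G₂ G₃ x₀ x₁ x₂ x₃) ∨
      FormB m n (quadSeq m G₀ G₁ G₂ G₃ x₀ x₁ x₂ x₃) := by
  have hm0 : 0 < m := by omega
  have hP₃ : IndepMod m (φ (G₁ - G₀)) (φ (G₃ - G₀)) → G₀ + G₃ = G₁ + G₂ →
      m • (G₀ + G₃) = ι h + ι h' → FormA m n (quadSeq m G₀ G₁ G₂ G₃ x₀ x₁ x₂ x₃) ∨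
        FormB m n (quadSeq m G₀ G₁ G₂ G₃ x₀ x₁ x₂ x₃) := fun h1 h2 h3 => by
    have hq : quadSeq m G₀ G₁ G₂ G₃ x₀ x₁ x₂ x₃ = quadSeq m G₀ G₁ G₃ G₂ x₀ x₁ x₃ x₂ := by
      simp only [quadSeq]; abel
    rw [hq]
    exact form_of_parallelogram hm0 hn hH hι hker hh hh' hne h1 h2 h3 (by rw [← hX]; abel)
  rcases hm.eq_or_lt with rfl | hm3
  · obtain rfl : x = 1 := by omega
    have hs := hk 1 1 le_rfl one_lt_two le_rfl one_lt_two (by rw [one_mul])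
    norm_num at hs
    have hmem : ∀ y, y = ι h ∨ y = ι h' →
        y = 2 • G₀ ∨ y = 2 • G₁ ∨ y = 2 • G₂ ∨ y = 2 • G₃ := fun y hy => by
      have : y ∈ Multiset.replicate (n - 1) (ι h) + Multiset.replicate (n - 1) (ι h') := by
        simp only [Multiset.mem_add, Multiset.mem_replicate]
        exact hy.imp (fun h => ⟨by omega, h⟩) (fun h => ⟨by omega, h⟩)
      rw [← hX] at this
      simp only [Multiset.mem_add, Multiset.mem_replicate] at this
      tauto
    have hpair : G₀ + G₂ = G₁ + G₃ ∨ G₀ + G₃ = G₁ + G₂ ∨ G₀ + G₁ = G₂ + G₃ := by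
      have hne' := hι.ne hne
      rcases hmem _ (Or.inl rfl) with e | e | e | e <;>
        rcases hmem _ (Or.inr rfl) with e' | e' | e' | e' <;> rw [e, e'] at hs hne' <;>
        first
        | exact absurd rfl hne'
        | exact Or.inl (by linear_combination (norm := module) hs)
        | exact Or.inl (by linear_combination (norm := module) -hs)
        | exact Or.inr (Or.inl (by linear_combination (norm := module) hs))
        | exact Or.inr (Or.inl (by linear_combination (norm := module) -hs))
        | exact Or.inr (Or.inr (by linear_combination (norm := module) hs))
        | exact Or.inr (Or.inr (by linear_combination (norm := module) -hs))
    rcases hpair with hp | hp | hp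
    · exact form_of_parallelogram hm0 hn hH hι hker hh hh' hne hind hp
        (by linear_combination (norm := module) hs + hp) hX
    · refine hP₃ ?_ hp (by linear_combination (norm := module) hs + hp)
      have := hind.add_zsmul (-1)
      convert this using 1
      simp only [map_sub] at hG₃ ⊢
      linear_combination (norm := module) hG₃
    · have hq : quadSeq 2 G₀ G₁ G₂ G₃ x₀ x₁ x₂ x₃ = quadSeq 2 G₀ G₂ G₁ G₃ x₀ x₂ x₁ x₃ := by
        simp only [quadSeq]; abel
      rw [hq]
      exact form_of_parallelogram hm0 hn hH hι hker hh hh' hne hind.swap hp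
        (by linear_combination (norm := module) hs + hp) (by rw [← hX]; abel)
  · rcases relation_of_walk (E := G₁ - G₀) (D := G₃ - G₂)
      (C := ι h + ι h' - m • G₀ - m • G₂) hm3 hx1 hxm hx (fun k y h1 h2 h3 h4 h5 => by
        have e1 : (m - y) • G₀ + y • G₀ = m • G₀ := by rw [← add_smul, Nat.sub_add_cancel h4.le]
        have e2 : (m - k) • G₂ + k • G₂ = m • G₂ := by rw [← add_smul, Nat.sub_add_cancel h2.le]
        linear_combination (norm := module) hk k y h1 h2 h3 h4 h5 - e1 - e2) with
      ⟨e1, e2⟩ | ⟨e1, e2⟩ | ⟨e1, e2⟩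
    · left
      refine formA_of_nsmul_eq hm0 hn hH hι hker hh hh' hne hind hx e2 hX ?_ ?_
      · linear_combination (norm := module) -e1
      · have : m • (x • (G₁ - G₀) + (G₃ - G₂)) = 0 := by rw [e2, smul_zero]
        rw [smul_add, smul_comm, e1, smul_zero, zero_add] at this
        linear_combination (norm := module) -this
    · exact form_of_parallelogram hm0 hn hH hι hker hh hh' hne hind
        (by linear_combination (norm := module) -e1)
        (by linear_combination (norm := module) -e2) hX
    · have hp : G₀ + G₃ = G₁ + G₂ := by linear_combination (norm := module) e1
      refine hP₃ ?_ hp ?_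
      · have := hind.add_zsmul 1
        rw [one_smul, ← map_add] at this
        convert this using 2
        linear_combination (norm := module) hp
      · rw [hp]
        linear_combination (norm := module) -e2

end Extremal

section Main

variable {G H : Type*} [AddCommGroup G] [AddCommGroup H]

theorem form_of_noZeroSum [Fintype H] {φ : G →+ H} {m n : ℕ} {ι : ZMod n →+ G} (hm : 2 ≤ m)
    (hn : 2 ≤ n) (hexp : ∀ x : H, m • x = 0) (hH : Fintype.card H = m * m)
    (hι : Function.Injective ι) (hker : ∀ g, φ g = 0 → ∃ k, ι k = g)
    (hD : ∀ S : Multiset H, Multiset.card S = 4 * (m - 1) → NoZeroSum m S →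
      ∃ T, Multiset.card T = 4 ∧ S = (m - 1) • T)
    {S : Multiset G} (hcard : Multiset.card S = 4 * (m - 1) + (2 * n - 2) * m)
    (hS : NoZeroSum (m * n) S) : FormA m n S ∨ FormB m n S := by
  obtain ⟨R, X, T, h, h', rfl, hRT, hT, -, hTz, hXT, hXR, hX, hhz⟩ :=
    exists_extremal_structure φ hm hn hexp (not_noZeroSum_of_lt_card hm hexp hH hD) hD
      (InverseEGZ.of_pos (by omega)) ι hι hker hcard hS
  have hm0 : 0 < m := by omega
  have hsum : ∀ z ≤ R, Multiset.card z = 2 * m → φ z.sum = 0 → z.sum = ι h + ι h' := by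
    intro z hz hzc hz0
    obtain ⟨k, hk⟩ := hker _ hz0
    rw [← hk, ← map_add]
    congr 1
    refine NoZeroSum.sum_eq hn hhz fun Y hY hYc h0 => ?_
    obtain ⟨V, hV, hVY⟩ := Multiset.exists_le_map_eq (fun x => m • x) X (Y.map ι)
      (hX ▸ Multiset.map_le_map hY)
    refine hS ⟨z + m • V, add_le_add hz (nsmul_le_nsmul_right hV m), ?_, ?_⟩
    · have h1 : m • V.sum = ι Y.sum := by
        rw [map_multiset_sum, ← hVY, Multiset.sum_map_nsmul, Multiset.map_id']
      rw [Multiset.sum_add, Multiset.sum_nsmul, h1, ← hk, ← map_add, h0, map_zero]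
    · have h1 := congrArg Multiset.card hVY
      rw [Multiset.card_map, Multiset.card_map, hYc] at h1
      rw [Multiset.card_add, Multiset.card_nsmul, hzc, h1, mul_comm 2, ← mul_add]
      congr 1; omega
  obtain ⟨t₀, t₁, t₂, t₃, x, rfl, hx1, hxm, hx, ht₃, hind⟩ := hTz.exists_vertices hm hexp hH hT
  have hzero : ∀ k y : ℕ, k ≤ m → y ≤ m → y ≡ k * x [MOD m] →
      (m - y) • t₀ + y • t₁ + (m - k) • t₂ + k • t₃ = 0 := by
    intro k y hk hy hyk
    have e0 : (m - y) • t₀ + y • t₀ = 0 := by rw [← add_smul, Nat.sub_add_cancel hy, hexp]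
    have e2 : (m - k) • t₂ + k • t₂ = 0 := by rw [← add_smul, Nat.sub_add_cancel hk, hexp]
    have e1 : y • (t₁ - t₀) = (k * x) • (t₁ - t₀) := by
      rw [← nsmul_mod_of_nsmul_eq_zero (hexp _) y, hyk, nsmul_mod_of_nsmul_eq_zero (hexp _)]
    have e3 : k • (x • (t₁ - t₀) + (t₃ - t₂)) = 0 := by rw [ht₃, smul_zero]
    linear_combination (norm := module) e0 + e1 + e2 + e3
  have hTm : (m - 1) • ({t₀, t₁, t₂, t₃} : Multiset H) = Multiset.replicate (m - 1) t₀ +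
      Multiset.replicate (m - 1) t₁ + Multiset.replicate (m - 1) t₂ +
      Multiset.replicate (m - 1) t₃ := by
    simp only [Multiset.insert_eq_cons, ← Multiset.singleton_add, nsmul_add,
      Multiset.nsmul_singleton, add_assoc]
  rw [hTm] at hRT
  obtain ⟨R', R₃, rfl, hR', hR₃⟩ := Multiset.exists_eq_add_of_map_eq_add hRT
  obtain ⟨R', R₂, rfl, hR', hR₂⟩ := Multiset.exists_eq_add_of_map_eq_add hR'
  obtain ⟨R₀, R₁, rfl, hR₀, hR₁⟩ := Multiset.exists_eq_add_of_map_eq_add hR'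
  obtain ⟨k, hk1, hkm, hk⟩ := exists_mul_modEq hm hx
  have hk' : m - 1 ≡ (m - k) * x [MOD m] := by
    refine Nat.ModEq.add_right_cancel hk ?_
    rw [← add_mul, Nat.sub_add_cancel hkm.le, Nat.sub_add_cancel (by omega)]
    simp [Nat.ModEq]
  have hx' : m - x ≡ (m - 1) * x [MOD m] := by
    refine Nat.ModEq.add_right_cancel' x ?_
    rw [Nat.sub_add_cancel hxm.le, ← Nat.succ_mul, Nat.succ_eq_add_one,
      Nat.sub_add_cancel (by omega)]
    simp [Nat.ModEq]
  obtain ⟨G₀, hG₀, rfl⟩ := exists_eq_replicate_of_swap (c₁ := m - 1) (c₂ := k) (c₃ := m - k)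
    hR₀ hR₁ hR₂ hR₃ hsum le_rfl (by omega) (by omega) (by omega) (by
      have := hzero (m - k) (m - 1) (by omega) (by omega) hk'
      rwa [Nat.sub_sub_self hkm.le, Nat.sub_sub_self (by omega), one_smul] at this)
  obtain ⟨G₁, hG₁, rfl⟩ := exists_eq_replicate_of_swap (c₁ := m - 1) (c₂ := m - k) (c₃ := k)
    hR₁ hR₀ hR₂ hR₃ (by rwa [add_comm R₁]) le_rfl (by omega) (by omega) (by omega) (by
      have := hzero k 1 (by omega) (by omega) hk
      rw [one_smul] at this
      rwa [add_comm t₁])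
  obtain ⟨G₂, hG₂, rfl⟩ := exists_eq_replicate_of_swap (c₁ := x) (c₂ := m - x) (c₃ := m - 1)
    hR₂ hR₀ hR₁ hR₃ (by rwa [add_assoc R₂, add_comm R₂]) (by omega) (by omega) le_rfl
    (by omega) (by
      have := hzero (m - 1) (m - x) (by omega) (by omega) hx'
      rw [Nat.sub_sub_self hxm.le, Nat.sub_sub_self (by omega), one_smul] at this
      rw [← this]; abel)
  obtain ⟨G₃, hG₃, rfl⟩ := exists_eq_replicate_of_swap (c₁ := m - x) (c₂ := x) (c₃ := m - 1)
    hR₃ hR₀ hR₁ hR₂ (by rwa [add_assoc R₃, add_assoc R₃, add_comm R₃]) (by omega) (by omega)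
    le_rfl (by omega) (by
      have := hzero 1 x (by omega) hxm.le (by rw [one_mul])
      rw [one_smul] at this
      rw [← this]; abel)
  subst hG₀ hG₁ hG₂ hG₃
  have hrep : ∀ g : G, g ∈ Multiset.replicate (m - 1) g := fun g =>
    Multiset.mem_replicate.2 ⟨by omega, rfl⟩
  obtain ⟨x₀, x₁, x₂, x₃, rfl⟩ := X.exists_eq_replicate_of_mem (a := G₀) (b := G₁) (c := G₂)
    (d := G₃) (by
      intro y hy
      have := hXT y hy
      simp only [Multiset.insert_eq_cons, Multiset.mem_cons, Multiset.mem_singleton] at this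
      have h1 := fun g hg hgy => hXR y hy g hg hgy
      simp only [Multiset.mem_add] at h1
      rcases this with e | e | e | e
      · exact Or.inl (h1 _ (by simp [hrep]) e)
      · exact Or.inr (Or.inl (h1 _ (by simp [hrep]) e))
      · exact Or.inr (Or.inr (Or.inl (h1 _ (by simp [hrep]) e)))
      · exact Or.inr (Or.inr (Or.inr (h1 _ (by simp [hrep]) e))))
  have hq : Multiset.replicate (m - 1) G₀ + Multiset.replicate (m - 1) G₁ +
      Multiset.replicate (m - 1) G₂ + Multiset.replicate (m - 1) G₃ +
      m • (Multiset.replicate x₀ G₀ + Multiset.replicate x₁ G₁ + Multiset.replicate x₂ G₂ +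
        Multiset.replicate x₃ G₃) = quadSeq m G₀ G₁ G₂ G₃ x₀ x₁ x₂ x₃ := by
    simp only [quadSeq, Multiset.replicate_add, ← Multiset.nsmul_replicate, nsmul_add]
    abel
  rw [hq]
  have hhz' := hhz
  rw [add_comm] at hhz'
  refine form_of_quadSeq hm hn hH hι hker (h := h) (h' := h') (x := x) ?_ ?_ ?_ ?_ hx1 hxm hx ?_
    ?_ ?_
  · intro z
    obtain ⟨i, -, hi⟩ := hhz.exists_nsmul_eq (by omega) z
    exact ⟨i, hi⟩
  · intro z
    obtain ⟨i, -, hi⟩ := hhz'.exists_nsmul_eq (by omega) z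
    exact ⟨i, hi⟩
  · rintro rfl
    obtain ⟨i, -, hi⟩ := hhz.exists_nsmul_eq (by omega) 1
    rw [sub_self, smul_zero] at hi
    have : Fact (1 < n) := ⟨hn⟩
    exact one_ne_zero hi
  · simpa only [map_sub] using hind
  · simpa only [map_sub] using ht₃
  · intro k y _ hk2 _ hy2 hyk
    have := hsum (Multiset.replicate (m - y) G₀ + Multiset.replicate y G₁ +
      Multiset.replicate (m - k) G₂ + Multiset.replicate k G₃)
      (by
        refine add_le_add (add_le_add (add_le_add ?_ ?_) ?_) ?_ <;>
          exact (Multiset.replicate_le_replicate _).2 (by omega))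
      (by simp only [Multiset.card_add, Multiset.card_replicate]; omega)
      (by
        simp only [Multiset.sum_add, Multiset.sum_replicate, map_add, map_nsmul]
        exact hzero k y hk2.le hy2.le hyk)
    simpa only [Multiset.sum_add, Multiset.sum_replicate] using this
  · simpa only [Multiset.map_add, Multiset.map_replicate] using hX

theorem formA_of_injective [Fintype H] {φ : G →+ H} {m : ℕ} (hm : 2 ≤ m)
    (hexp : ∀ x : H, m • x = 0) (hH : Fintype.card H = m * m) (hφ : Function.Injective φ)
    (hD : ∀ S : Multiset H, Multiset.card S = 4 * (m - 1) → NoZeroSum m S →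
      ∃ T, Multiset.card T = 4 ∧ S = (m - 1) • T)
    {S : Multiset G} (hcard : Multiset.card S = 4 * (m - 1)) (hS : NoZeroSum m S) :
    FormA m 1 S := by
  have hSφ : NoZeroSum m (S.map φ) := by
    rintro ⟨U, hU, h0, hc⟩
    obtain ⟨V, hV, rfl⟩ := Multiset.exists_le_map_eq φ S U hU
    exact hS ⟨V, hV, hφ (by rw [map_multiset_sum, h0, map_zero]),
      by rwa [Multiset.card_map] at hc⟩
  obtain ⟨T, hT, hST⟩ := hD (S.map φ) (by rwa [Multiset.card_map]) hSφ
  obtain ⟨t₀, t₁, t₂, t₃, x, rfl, hx1, hxm, hx, ht₃, hind⟩ :=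
    (hST ▸ hSφ).exists_vertices hm hexp hH hT
  have hmem : ∀ t ∈ ({t₀, t₁, t₂, t₃} : Multiset H), ∃ g, φ g = t := fun t ht => by
    have : t ∈ S.map φ := by rw [hST]; exact (Multiset.mem_nsmul_of_ne_zero (by omega)).2 ht
    obtain ⟨g, -, hg⟩ := Multiset.mem_map.1 this
    exact ⟨g, hg⟩
  obtain ⟨G₀, rfl⟩ := hmem t₀ (by simp)
  obtain ⟨G₁, rfl⟩ := hmem t₁ (by simp)
  obtain ⟨G₂, rfl⟩ := hmem t₂ (by simp)
  obtain ⟨G₃, rfl⟩ := hmem t₃ (by simp)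
  have hS' : S = quadSeq m G₀ G₁ G₂ G₃ 0 0 0 0 := by
    apply Multiset.map_injective hφ
    rw [hST]
    simp only [quadSeq, Multiset.map_add, Multiset.map_replicate, mul_zero, add_zero,
      Multiset.insert_eq_cons, ← Multiset.singleton_add, nsmul_add, Multiset.nsmul_singleton,
      add_assoc]
  rw [hS']
  have hexp' : ∀ g : G, m • g = 0 := fun g => hφ (by rw [map_nsmul, hexp, map_zero])
  exact formA_quadSeq (φ := φ) (ι := (0 : ZMod 1 →+ G)) (d := 0) (by omega) one_pos hH
    (Function.injective_of_subsingleton _)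
    (fun g hg => ⟨0, hφ (by rw [hg]; simp)⟩) (by simpa only [map_sub] using hind)
    (by rw [hexp', map_zero]) (fun z => ⟨0, Subsingleton.elim _ _⟩) (hexp' _) hx
    (hφ (by simpa only [map_sub, map_add, map_nsmul, map_zero] using ht₃)) rfl rfl

end Main

/-- Assuming `C_m ⊕ C_m` has Property D, every sequence over
`G = C_m ⊕ C_{mn}` of length `2m + 2mn - 4 = s(G) - 1` with no zero-sum subsequence of
length `mn = exp(G)` is of form (a) or (b). -/
theorem stmt_5 (m n : ℕ) (hm : 2 ≤ m) (hn : 0 < n)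
    (hPropD : ∀ S : Multiset (ZMod m × ZMod m), S.card = 4 * m - 4 →
      (¬ ∃ U ≤ S, U.sum = 0 ∧ Multiset.card U = m) →
      ∃ T : Multiset (ZMod m × ZMod m), T.card = 4 ∧ S = (m - 1) • T)
    (S : Multiset (ZMod m × ZMod (m * n)))
    (hcard : S.card = 2 * m + 2 * (m * n) - 4)
    (hnozs : ¬ ∃ T ≤ S, T.sum = 0 ∧ Multiset.card T = m * n) :
    (∃ (e1 e2 g : ZMod m × ZMod (m * n)) (x : ℤ) (s t : ℕ),
      (∀ a b : ℤ, a • e1 + b • e2 = 0 → a • e1 = 0 ∧ b • e2 = 0) ∧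
      AddSubgroup.closure ({e1, e2} : Set (ZMod m × ZMod (m * n))) = ⊤ ∧
      addOrderOf e2 = m * n ∧ Int.gcd x m = 1 ∧
      1 ≤ s ∧ s ≤ n ∧ 1 ≤ t ∧ t ≤ n ∧
      S = Multiset.replicate (t * m - 1) g +
            Multiset.replicate ((n + 1 - t) * m - 1) (e1 + g) +
            Multiset.replicate (s * m - 1) (e2 + g) +
            Multiset.replicate ((n + 1 - s) * m - 1) ((-x) • e1 + e2 + g)) ∨
    (∃ g1 g2 g : ZMod m × ZMod (m * n),
      AddSubgroup.closure ({g1, g2} : Set (ZMod m × ZMod (m * n))) = ⊤ ∧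
      addOrderOf g2 = m * n ∧
      S = Multiset.replicate (m * n - 1) g +
            Multiset.replicate (m - 1) (g1 + g) +
            Multiset.replicate (m * n - 1) (g2 + g) +
            Multiset.replicate (m - 1) (-g1 + g2 + g)) := by
  let φ : ZMod m × ZMod (m * n) →+ ZMod m × ZMod m :=
    (AddMonoidHom.id _).prodMap (ZMod.castHom (dvd_mul_right m n) (ZMod m)).toAddMonoidHom
  let ι : ZMod n →+ ZMod m × ZMod (m * n) := (AddMonoidHom.inr _ _).comp (ZMod.mulEmbedding m n)
  have hm0 : 0 < m := by omega
  have : NeZero m := ⟨hm0.ne'⟩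
  have hι : Function.Injective ι := fun a b hab =>
    ZMod.mulEmbedding_injective hm0 hn (congrArg Prod.snd hab)
  have hker : ∀ g, φ g = 0 → ∃ k, ι k = g := by
    rintro ⟨g₁, g₂⟩ hg
    obtain ⟨k, hk⟩ := ZMod.exists_mulEmbedding_eq hm0 hn g₂ (congrArg Prod.snd hg)
    exact ⟨k, Prod.ext (congrArg Prod.fst hg).symm hk⟩
  have hexp : ∀ x : ZMod m × ZMod m, m • x = 0 := fun x => by ext <;> simp
  have hH : Fintype.card (ZMod m × ZMod m) = m * m := by simp [ZMod.card]
  have hD : ∀ S : Multiset (ZMod m × ZMod m), Multiset.card S = 4 * (m - 1) → NoZeroSum m S →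
      ∃ T, Multiset.card T = 4 ∧ S = (m - 1) • T := fun S hS h => hPropD S (by omega) h
  obtain rfl | hn2 := (show 1 ≤ n from hn).eq_or_lt
  · have hφ : Function.Injective φ := (injective_iff_map_eq_zero φ).2 fun g hg => by
      obtain ⟨k, rfl⟩ := hker g hg
      rw [Subsingleton.elim k 0, map_zero]
    have hS : NoZeroSum m S := by simpa only [NoZeroSum, mul_one] using hnozs
    exact Or.inl (formA_of_injective hm hexp hH hφ hD (by omega) hS)
  · refine form_of_noZeroSum hm hn2 hexp hH hι hker hD ?_ hnozs
    obtain ⟨k, rfl⟩ : ∃ k, n = k + 1 := ⟨n - 1, by omega⟩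
    have h1 : 2 * (m * (k + 1)) = 2 * m + 2 * k * m := by ring
    rw [hcard, h1, (by omega : 2 * (k + 1) - 2 = 2 * k)]
    omega
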